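/- arXiv:2301.01734 — 3 statements merged into one kernel-verified Lean document; each statement's English description precedes it below -/
import Mathlib

section
/- Theorem 2 (deterministic error bound for Coarray ESPRIT): Let 𝕊 be a hole-free sparse linear array with largest difference M_ca, let ω₁, …, ω_S ∈ [0,1) be distinct with S ≤ M_ca, let p₁, …, p_S > 0 and σ² ≥ 0, and set T_ca = A_U(ω) diag(p) A_U(ω)ᴴ + σ²I, where A_U(ω) ∈ ℂ^{(M_ca+1)×S} is the coarray manifold. Let T̂_ca be any Hermitian matrix of the same size and E_L = T_ca − T̂_ca. Define β = p_min σ_S(A_U(ω))² − σ², C_S = 2^{−S}/(4√2), C_S' = 14√2 π S^{3/2} 4^S, and q = C_S' √(M_ca+1)/(β σ_S(A_U(ω))). If β > 0 and ‖E_L‖₂ ≤ C_S β, then the Coarray ESPRIT estimates ω̂₁, …, ω̂_S computed from T̂_ca satisfy md(ω, ω̂) ≤ q ‖E_L‖₂. -/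
open Matrix

noncomputable section

/-- Spectral norm (largest singular value) of a complex matrix. -/
def specNorm {m n : ℕ} (A : Matrix (Fin m) (Fin n) ℂ) : ℝ :=
  ‖LinearMap.toContinuousLinearMap (Matrix.toEuclideanLin A)‖

/-- `k`-th largest singular value (Courant–Fischer min-max characterization). -/
def sval {m n : ℕ} (A : Matrix (Fin m) (Fin n) ℂ) (k : ℕ) : ℝ :=
  sSup {r : ℝ | 0 ≤ r ∧ ∃ V : Submodule ℂ (EuclideanSpace ℂ (Fin n)),
    Module.finrank ℂ V = k ∧ ∀ x ∈ V, r * ‖x‖ ≤ ‖Matrix.toEuclideanLin A x‖}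

/-- Matching distance between two lists of normalized frequencies. -/
def mdist {S : ℕ} (ω ωh : Fin S → ℝ) : ℝ :=
  ⨅ π : Equiv.Perm (Fin S), ⨆ j : Fin S, ⨅ k : ℤ, |ωh (π j) - ω j + (k : ℝ)|

/-- Array manifold matrix: entries `exp(i 2π d_k ω_i)`. -/
def steering {P S : ℕ} (d : Fin P → ℤ) (ω : Fin S → ℝ) : Matrix (Fin P) (Fin S) ℂ :=
  Matrix.of fun k i => Complex.exp (Complex.I * (2 * Real.pi * (d k : ℝ) * ω i))

/-- The array is hole-free with largest difference `Mca`. -/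
def HoleFree {P : ℕ} (d : Fin P → ℤ) (Mca : ℕ) : Prop :=
  {i : ℤ | ∃ m n : Fin P, d m - d n = i} = Set.Icc (-(Mca : ℤ)) (Mca : ℤ)

/-- Moore–Penrose pseudoinverse of a full-column-rank matrix. -/
def pinv {m n : ℕ} (B : Matrix (Fin m) (Fin n) ℂ) : Matrix (Fin n) (Fin m) ℂ :=
  (Bᴴ * B)⁻¹ * Bᴴ

/-- First `M` rows. -/
def rowsInit {M S : ℕ} (U : Matrix (Fin (M + 1)) (Fin S) ℂ) : Matrix (Fin M) (Fin S) ℂ :=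
  U.submatrix Fin.castSucc id

/-- Last `M` rows. -/
def rowsTail {M S : ℕ} (U : Matrix (Fin (M + 1)) (Fin S) ℂ) : Matrix (Fin M) (Fin S) ℂ :=
  U.submatrix Fin.succ id

/-- The ESPRIT matrix `Ψ = U₀† U₁`. -/
def espritMat {M S : ℕ} (U : Matrix (Fin (M + 1)) (Fin S) ℂ) : Matrix (Fin S) (Fin S) ℂ :=
  pinv (rowsInit U) * rowsTail U

/-- `U` has orthonormal columns which are eigenvectors of `T` spanning the eigenspace of the
`S` largest eigenvalues of `T`. -/
def IsTopEigenbasis {N S : ℕ} (T : Matrix (Fin N) (Fin N) ℂ) (U : Matrix (Fin N) (Fin S) ℂ) :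
    Prop :=
  Uᴴ * U = 1 ∧ ∃ μ : Fin S → ℝ,
    T * U = U * Matrix.diagonal (fun i => (μ i : ℂ)) ∧
    ∀ (ν : ℝ) (v : Fin N → ℂ), v ≠ 0 → T.mulVec v = (ν : ℂ) • v →
      Uᴴ.mulVec v = 0 → ∀ i, ν ≤ μ i

/-- `lam` is a listing of the eigenvalues of `Ψ` with multiplicity. -/
def IsEigList {S : ℕ} (Ψ : Matrix (Fin S) (Fin S) ℂ) (lam : Fin S → ℂ) : Prop :=
  Ψ.charpoly = ∏ i : Fin S, (Polynomial.X - Polynomial.C (lam i))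

end

/-- Euclidean norm of a complex vector. -/
noncomputable def nv {n : ℕ} (v : Fin n → ℂ) : ℝ := ‖(WithLp.toLp 2 v : EuclideanSpace ℂ (Fin n))‖

lemma nv_nonneg {n : ℕ} (v : Fin n → ℂ) : 0 ≤ nv v := norm_nonneg _

lemma nv_sq {n : ℕ} (v : Fin n → ℂ) : nv v ^ 2 = ∑ i, ‖v i‖ ^ 2 := by
  unfold nv; rw [EuclideanSpace.norm_sq_eq]

lemma nv_add_le {n : ℕ} (v w : Fin n → ℂ) : nv (v + w) ≤ nv v + nv w := by
  unfold nv; rw [WithLp.toLp_add]; exact norm_add_le _ _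

lemma nv_sub_le {n : ℕ} (v w : Fin n → ℂ) : nv (v - w) ≤ nv v + nv w := by
  unfold nv; rw [WithLp.toLp_sub]; exact norm_sub_le _ _

lemma nv_zero {n : ℕ} : nv (0 : Fin n → ℂ) = 0 := by
  unfold nv; simp

lemma nv_pos {n : ℕ} {v : Fin n → ℂ} (h : v ≠ 0) : 0 < nv v := by
  unfold nv; rw [norm_pos_iff]; simpa using h

lemma nv_eq_zero {n : ℕ} {v : Fin n → ℂ} (h : nv v ≤ 0) : v = 0 := by
  by_contra hv
  exact absurd (nv_pos hv) (not_lt.mpr h)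

lemma dot_self {n : ℕ} (v : Fin n → ℂ) : star v ⬝ᵥ v = ((nv v ^ 2 : ℝ) : ℂ) := by
  rw [nv_sq]
  simp only [dotProduct, Pi.star_apply, RCLike.star_def, Complex.conj_mul']
  push_cast; rfl

lemma dot_le {n : ℕ} (v w : Fin n → ℂ) : ‖star v ⬝ᵥ w‖ ≤ nv v * nv w := by
  have := norm_inner_le_norm (𝕜 := ℂ) (WithLp.toLp 2 v : EuclideanSpace ℂ (Fin n)) (WithLp.toLp 2 w)
  rw [EuclideanSpace.inner_toLp_toLp, dotProduct_comm] at this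
  exact this

lemma sn_mulVec {m n : ℕ} (A : Matrix (Fin m) (Fin n) ℂ) (v : Fin n → ℂ) :
    nv (A *ᵥ v) ≤ specNorm A * nv v :=
  (LinearMap.toContinuousLinearMap (Matrix.toEuclideanLin A)).le_opNorm (WithLp.toLp 2 v)

lemma sn_nonneg {m n : ℕ} (A : Matrix (Fin m) (Fin n) ℂ) : 0 ≤ specNorm A := norm_nonneg _

lemma sn_le {m n : ℕ} (A : Matrix (Fin m) (Fin n) ℂ) {K : ℝ} (hK : 0 ≤ K)
    (h : ∀ v, nv (A *ᵥ v) ≤ K * nv v) : specNorm A ≤ K := by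
  refine ContinuousLinearMap.opNorm_le_bound _ hK fun x => ?_
  exact h x.ofLp

/-- isometry -/
lemma nv_isom {m n : ℕ} {U : Matrix (Fin m) (Fin n) ℂ} (h : Uᴴ * U = 1) (v : Fin n → ℂ) :
    nv (U *ᵥ v) = nv v := by
  have h1 := dot_self (U *ᵥ v)
  rw [star_mulVec, ← dotProduct_mulVec, mulVec_mulVec, h, one_mulVec, dot_self] at h1
  have h2 : nv v ^ 2 = nv (U *ᵥ v) ^ 2 := by exact_mod_cast h1
  exact ((sq_eq_sq₀ (nv_nonneg _) (nv_nonneg _)).mp h2).symm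

lemma nv_herm_idem {n : ℕ} {Q : Matrix (Fin n) (Fin n) ℂ} (h : Qᴴ * Q = Q) (v : Fin n → ℂ) :
    nv (Q *ᵥ v) ≤ nv v := by
  have h1 := dot_self (Q *ᵥ v)
  rw [star_mulVec, ← dotProduct_mulVec, mulVec_mulVec, h] at h1
  have h2 := dot_le v (Q *ᵥ v)
  rw [h1, Complex.norm_real, Real.norm_of_nonneg (sq_nonneg _)] at h2
  by_contra hc
  push Not at hc
  have := nv_nonneg v
  nlinarith

lemma sval_le {m n : ℕ} (A : Matrix (Fin m) (Fin n) ℂ) (v : Fin n → ℂ) :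
    sval A n * nv v ≤ nv (A *ᵥ v) := by
  by_cases hv : v = 0
  · subst hv; simp [nv_zero]
  have hp := nv_pos hv
  rw [← le_div_iff₀ hp]
  refine csSup_le ⟨0, le_rfl, ⊤, by simp, fun x _ => by simp⟩ ?_
  rintro r ⟨_, V, hV, h⟩
  have hT : V = ⊤ := Submodule.eq_top_of_finrank_eq (by rw [hV]; simp)
  rw [le_div_iff₀ hp]
  exact h (WithLp.toLp 2 v) (by rw [hT]; trivial)

lemma sval_nonneg {m n : ℕ} (A : Matrix (Fin m) (Fin n) ℂ) (k : ℕ) : 0 ≤ sval A k :=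
  Real.sSup_nonneg fun _ h => h.1

/-- injective square matrices are invertible -/
lemma det_unit_of_lower {n : ℕ} {B : Matrix (Fin n) (Fin n) ℂ}
    (h : ∀ v, B *ᵥ v = 0 → v = 0) : IsUnit B.det := by
  rw [isUnit_iff_ne_zero]
  intro h0
  obtain ⟨v, hv, hB⟩ := Matrix.exists_mulVec_eq_zero_iff.mpr h0
  exact hv (h v hB)

lemma gram_det_unit {m n : ℕ} {B : Matrix (Fin m) (Fin n) ℂ} {κ : ℝ} (hκ : 0 < κ)
    (h : ∀ v, κ * nv v ≤ nv (B *ᵥ v)) : IsUnit (Bᴴ * B).det := by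
  refine det_unit_of_lower fun v hv => ?_
  have h1 := dot_self (B *ᵥ v)
  rw [star_mulVec, ← dotProduct_mulVec, mulVec_mulVec, hv, dotProduct_zero] at h1
  have h2 : nv (B *ᵥ v) ^ 2 = 0 := by exact_mod_cast h1.symm
  have h3 : nv (B *ᵥ v) = 0 := by simpa using h2
  have := h v
  apply nv_eq_zero
  rw [h3] at this
  by_contra hc
  push Not at hc
  nlinarith

lemma pinv_mul {m n : ℕ} {B : Matrix (Fin m) (Fin n) ℂ} {κ : ℝ} (hκ : 0 < κ)
    (h : ∀ v, κ * nv v ≤ nv (B *ᵥ v)) : pinv B * B = 1 := by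
  unfold pinv
  rw [Matrix.mul_assoc, Matrix.nonsing_inv_mul _ (gram_det_unit hκ h)]

lemma pinv_bound {m n : ℕ} {B : Matrix (Fin m) (Fin n) ℂ} {κ : ℝ} (hκ : 0 < κ)
    (h : ∀ v, κ * nv v ≤ nv (B *ᵥ v)) (y : Fin m → ℂ) : κ * nv (pinv B *ᵥ y) ≤ nv y := by
  refine (h _).trans ?_
  rw [mulVec_mulVec]
  refine nv_herm_idem ?_ y
  have hu := gram_det_unit hκ h
  have hp := pinv_mul hκ h
  have hH : (B * pinv B)ᴴ = B * pinv B := by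
    unfold pinv
    rw [conjTranspose_mul, conjTranspose_mul, conjTranspose_nonsing_inv, conjTranspose_mul,
      conjTranspose_conjTranspose, Matrix.mul_assoc]
  rw [hH, Matrix.mul_assoc, ← Matrix.mul_assoc (pinv B), hp, Matrix.one_mul]

lemma nv_perp {m n : ℕ} {B : Matrix (Fin m) (Fin n) ℂ} {κ : ℝ} (hκ : 0 < κ)
    (h : ∀ v, κ * nv v ≤ nv (B *ᵥ v)) (y : Fin m → ℂ) :
    nv ((1 - B * pinv B) *ᵥ y) ≤ nv y := by
  refine nv_herm_idem ?_ y
  have hp := pinv_mul hκ h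
  have hH : (B * pinv B)ᴴ = B * pinv B := by
    unfold pinv
    rw [conjTranspose_mul, conjTranspose_mul, conjTranspose_nonsing_inv, conjTranspose_mul,
      conjTranspose_conjTranspose, Matrix.mul_assoc]
  have hI : B * pinv B * (B * pinv B) = B * pinv B := by
    rw [Matrix.mul_assoc, ← Matrix.mul_assoc (pinv B), hp, Matrix.one_mul]
  rw [conjTranspose_sub, conjTranspose_one, hH, Matrix.mul_sub, Matrix.sub_mul, Matrix.sub_mul, hI]
  simp

/-- angle bound -/
lemma arg_bound (w : ℝ) (l : ℂ) :
    ∃ k : ℤ, |l.arg / (2 * Real.pi) - w + k| ≤ ‖l - Complex.exp (Complex.I * (2 * Real.pi * w))‖ / 2 := by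
  have hpi := Real.pi_pos
  set z := Complex.exp (Complex.I * (2 * Real.pi * w)) with hz
  obtain ⟨k, hk⟩ : ∃ k : ℤ, |l.arg / (2 * Real.pi) - w + k| ≤ 1 / 2 := by
    refine ⟨-round (l.arg / (2 * Real.pi) - w), ?_⟩
    push_cast
    exact abs_sub_round _
  refine ⟨k, ?_⟩
  set x := l.arg / (2 * Real.pi) - w + k with hx
  have hd : ‖l - z‖ = ‖(‖l‖ : ℂ) * Complex.exp (Complex.I * (2 * Real.pi * x)) - 1‖ := by
    have e1 : l = ‖l‖ * Complex.exp (l.arg * Complex.I) := (Complex.norm_mul_exp_arg_mul_I l).symm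
    have e2 : (‖l‖ : ℂ) * Complex.exp (Complex.I * (2 * Real.pi * x)) = l * z⁻¹ := by
      conv_rhs => rw [e1]
      rw [hz, ← Complex.exp_neg, mul_assoc (‖l‖ : ℂ), ← Complex.exp_add]
      congr 1
      rw [Complex.exp_eq_exp_iff_exists_int]
      refine ⟨k, ?_⟩
      rw [hx]
      push_cast
      have : (Real.pi : ℂ) ≠ 0 := by exact_mod_cast hpi.ne'
      field_simp
      ring
    have hzn : ‖z‖ = 1 := by
      rw [hz, mul_comm]; exact_mod_cast Complex.norm_exp_ofReal_mul_I (2 * Real.pi * w)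
    have hz0 : z ≠ 0 := by rw [hz]; exact Complex.exp_ne_zero _
    rw [e2]
    have : l - z = (l * z⁻¹ - 1) * z := by field_simp
    rw [this, norm_mul, hzn, mul_one]
  rw [hd]
  set r := ‖l‖ with hr
  have hr0 : 0 ≤ r := norm_nonneg _
  have hcs : Complex.exp (Complex.I * (2 * Real.pi * x)) =
      (Real.cos (2 * Real.pi * x) : ℂ) + (Real.sin (2 * Real.pi * x) : ℂ) * Complex.I := by
    rw [mul_comm, Complex.exp_mul_I]; push_cast; rfl
  have hnsq : ‖(r : ℂ) * Complex.exp (Complex.I * (2 * Real.pi * x)) - 1‖ ^ 2 =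
      (r * Real.cos (2 * Real.pi * x) - 1) ^ 2 + (r * Real.sin (2 * Real.pi * x)) ^ 2 := by
    rw [hcs, Complex.sq_norm, Complex.normSq_apply]
    simp only [Complex.sub_re, Complex.sub_im, Complex.mul_re, Complex.mul_im, Complex.add_re,
      Complex.add_im, Complex.ofReal_re, Complex.ofReal_im, Complex.I_re, Complex.I_im,
      Complex.one_re, Complex.one_im]
    ring
  set N := ‖(r : ℂ) * Complex.exp (Complex.I * (2 * Real.pi * x)) - 1‖ with hN
  have hN0 : 0 ≤ N := norm_nonneg _
  have hpy := Real.sin_sq_add_cos_sq (2 * Real.pi * x)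
  have habs : |2 * Real.pi * x| = 2 * Real.pi * |x| := by
    rw [abs_mul, abs_of_pos (by positivity)]
  have hcos : Real.cos (2 * Real.pi * x) = Real.cos (2 * Real.pi * |x|) := by
    rw [← habs, Real.cos_abs]
  set c := Real.cos (2 * Real.pi * x) with hc
  set s := Real.sin (2 * Real.pi * x) with hs
  suffices h : (2 * |x|) ^ 2 ≤ N ^ 2 by
    have := abs_le_of_sq_le_sq' h hN0
    linarith [this.2]
  have hN2 : N ^ 2 = r ^ 2 - 2 * (r * c) + 1 := by
    rw [hnsq]; linear_combination r ^ 2 * hpy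
  rw [hN2]
  have hx0 := abs_nonneg x
  by_cases hq : |x| ≤ 1 / 4
  · -- N^2 ≥ sin^2 ≥ (2/π θ)^2
    have h1 : 4 * |x| ≤ Real.sin (2 * Real.pi * |x|) := by
      have := Real.mul_le_sin (x := 2 * Real.pi * |x|) (by positivity) (by nlinarith)
      calc 4 * |x| = 2 / Real.pi * (2 * Real.pi * |x|) := by field_simp; ring
        _ ≤ _ := this
    have h2 := Real.sin_sq_add_cos_sq (2 * Real.pi * |x|)
    rw [← hcos] at h2
    have h3 : (4 * |x|) ^ 2 ≤ Real.sin (2 * Real.pi * |x|) ^ 2 :=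
      pow_le_pow_left₀ (by positivity) h1 2
    nlinarith [sq_nonneg (r - c)]
  · push Not at hq
    have : c ≤ 0 := by
      rw [hcos]
      apply Real.cos_nonpos_of_pi_div_two_le_of_le <;> nlinarith
    have h4 : (2 * |x|) ^ 2 ≤ 1 := by nlinarith
    nlinarith [mul_nonneg hr0 (neg_nonneg.mpr this), sq_nonneg r]

/-- two root listings of the same polynomial agree up to a permutation -/
lemma exists_perm_of_prod_eq {S : ℕ} (r r' : Fin S → ℂ)
    (h : ∏ i, (Polynomial.X - Polynomial.C (r i)) = ∏ i, (Polynomial.X - Polynomial.C (r' i))) :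
    ∃ π : Equiv.Perm (Fin S), ∀ i, r' (π i) = r i := by
  classical
  have hroots : ∀ s : Fin S → ℂ, (∏ i, (Polynomial.X - Polynomial.C (s i))).roots
      = Finset.univ.val.map s := by
    intro s
    have := Polynomial.roots_multiset_prod_X_sub_C (Finset.univ.val.map s)
    rw [Multiset.map_map] at this
    exact this
  have hm : Finset.univ.val.map r = Finset.univ.val.map r' := by rw [← hroots, ← hroots, h]
  have hc : ∀ a : ℂ, Nonempty ({i // r i = a} ≃ {i // r' i = a}) := by
    intro a
    refine ⟨Fintype.equivOfCardEq ?_⟩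
    have h1 := congrArg (Multiset.count a) hm
    rw [Multiset.count_map, Multiset.count_map] at h1
    rw [Fintype.card_subtype, Fintype.card_subtype]
    simpa [Finset.card, eq_comm] using h1
  exact ⟨Equiv.ofFiberEquiv fun a => (hc a).some, fun i => Equiv.ofFiberEquiv_map _ i⟩

/-- root listings exist -/
lemma exists_rootlist {S : ℕ} (B : Matrix (Fin S) (Fin S) ℂ) :
    ∃ r : Fin S → ℂ, B.charpoly = ∏ i, (Polynomial.X - Polynomial.C (r i)) := by
  have hs : B.charpoly.Splits := IsAlgClosed.splits _
  have hm := Matrix.charpoly_monic B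
  have hcard : B.charpoly.roots.toList.length = S := by
    rw [Multiset.length_toList, ← hs.natDegree_eq_card_roots, Matrix.charpoly_natDegree_eq_dim]
    simp
  have hp := hs.eq_prod_roots_of_monic hm
  refine ⟨fun i => B.charpoly.roots.toList.get (i.cast hcard.symm), ?_⟩
  conv_lhs => rw [hp]
  conv_lhs => rw [← Multiset.coe_toList B.charpoly.roots]
  rw [Multiset.map_coe, Multiset.prod_coe]
  generalize B.charpoly.roots.toList = l at hcard
  subst hcard
  rw [← List.prod_ofFn]
  congr 1
  apply List.ext_get <;> simp

/-- Bauer–Fike for a diagonal matrix. -/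
lemma bauer_fike {S : ℕ} (z : Fin S → ℂ) (E : Matrix (Fin S) (Fin S) ℂ) {ε : ℝ}
    (hE : ∀ v, nv (E *ᵥ v) ≤ ε * nv v) (m : ℂ)
    (hm : (Matrix.diagonal z + E).charpoly.eval m = 0) : ∃ j, ‖m - z j‖ ≤ ε := by
  rw [Matrix.eval_charpoly] at hm
  obtain ⟨v, hv, hB⟩ := Matrix.exists_mulVec_eq_zero_iff.mpr hm
  by_contra hc
  push Not at hc
  have h1 : E *ᵥ v = fun i => (m - z i) * v i := by
    rw [sub_mulVec, add_mulVec] at hB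
    ext i
    have := congrFun hB i
    simp [Matrix.mulVec_diagonal, Matrix.scalar_apply] at this
    linear_combination -this
  have hε : 0 ≤ ε := by
    have := hE v
    have := nv_nonneg (E *ᵥ v)
    have := nv_pos hv
    by_contra hh
    push Not at hh
    nlinarith
  have h2 : (ε * nv v) ^ 2 < nv (E *ᵥ v) ^ 2 := by
    rw [mul_pow, nv_sq, nv_sq, h1, Finset.mul_sum]
    obtain ⟨i, hi⟩ : ∃ i, v i ≠ 0 := by
      by_contra hh; push Not at hh; exact hv (funext hh)
    refine Finset.sum_lt_sum (fun k _ => ?_) ⟨i, Finset.mem_univ _, ?_⟩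
    · rw [norm_mul, mul_pow]
      have := hc k
      gcongr
    · rw [norm_mul, mul_pow]
      have := hc i
      have : 0 < ‖v i‖ := norm_pos_iff.mpr hi
      gcongr
  have := pow_le_pow_left₀ (nv_nonneg _) (hE v) 2
  linarith

/-- Matching of eigenvalues of a perturbed diagonal matrix. -/
lemma eig_matching {S : ℕ} (z : Fin S → ℂ) (E : Matrix (Fin S) (Fin S) ℂ) {ε : ℝ} (hε : 0 ≤ ε)
    (hE : ∀ v, nv (E *ᵥ v) ≤ ε * nv v) (lam : Fin S → ℂ)
    (hl : (Matrix.diagonal z + E).charpoly = ∏ i, (Polynomial.X - Polynomial.C (lam i))) :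
    ∃ π : Equiv.Perm (Fin S), ∀ j, ‖lam (π j) - z j‖ ≤ 2 * S * ε := by
  classical
  let Γ : SimpleGraph (Fin S) := SimpleGraph.fromRel fun j k => ‖z j - z k‖ ≤ 2 * ε
  let D : Γ.ConnectedComponent → Set ℂ := fun c =>
    ⋃ j ∈ {j | Γ.connectedComponentMk j = c}, Metric.closedBall (z j) ε
  let c : Fin S → Γ.ConnectedComponent := Γ.connectedComponentMk
  have hDc : ∀ a, IsCompact (D a) := fun a =>
    (Set.toFinite _).isCompact_biUnion fun j _ => isCompact_closedBall _ _
  have hDdisj : ∀ a b x, x ∈ D a → x ∈ D b → a = b := by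
    intro a b x ha hb
    simp only [D, Set.mem_iUnion, Set.mem_ofPred_eq, Metric.mem_closedBall, dist_eq_norm] at ha hb
    obtain ⟨j, rfl, hj⟩ := ha
    obtain ⟨k, rfl, hk⟩ := hb
    by_cases hjk : j = k
    · rw [hjk]
    refine SimpleGraph.ConnectedComponent.sound (SimpleGraph.Adj.reachable ?_)
    rw [SimpleGraph.fromRel_adj]
    refine ⟨hjk, Or.inl ?_⟩
    calc ‖z j - z k‖ = ‖(x - z k) - (x - z j)‖ := by congr 1; ring
      _ ≤ ‖x - z k‖ + ‖x - z j‖ := norm_sub_le _ _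
      _ ≤ 2 * ε := by linarith
  let B : ℝ → Matrix (Fin S) (Fin S) ℂ := fun t => Matrix.diagonal z + (t : ℂ) • E
  have hBcont : Continuous B := by fun_prop
  have hBF : ∀ t ∈ Set.Icc (0:ℝ) 1, ∀ m, (B t).charpoly.eval m = 0 → ∃ j, ‖m - z j‖ ≤ ε := by
    intro t ht m hm
    refine bauer_fike z _ (fun v => ?_) m hm
    have h1 : nv (((t : ℂ) • E) *ᵥ v) = t * nv (E *ᵥ v) := by
      rw [smul_mulVec]
      unfold nv
      rw [WithLp.toLp_smul, norm_smul, Complex.norm_real, Real.norm_of_nonneg ht.1]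
    rw [h1]
    have := hE v
    have := nv_nonneg (E *ᵥ v)
    nlinarith [ht.1, ht.2]
  -- root listings compatible with a labelling
  let Z : (Fin S → Γ.ConnectedComponent) → Set ℝ := fun f =>
    {t | t ∈ Set.Icc (0:ℝ) 1 ∧ ∃ r : Fin S → ℂ,
      (B t).charpoly = (∏ i, (Polynomial.X - Polynomial.C (r i))) ∧ ∀ i, r i ∈ D (f i)}
  have hZclosed : ∀ f, IsClosed (Z f) := by
    intro f
    have hcomp : IsCompact (Set.Icc (0:ℝ) 1 ×ˢ Set.pi Set.univ fun i => D (f i)) :=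
      isCompact_Icc.prod (isCompact_univ_pi fun i => hDc _)
    let Q : Set (ℝ × (Fin S → ℂ)) := {q | ∀ w : ℂ,
      (Matrix.scalar _ w - B q.1).det = ∏ i, (w - q.2 i)}
    have hQ : IsClosed Q := by
      simp only [Q, Set.ofPred_forall]
      refine isClosed_iInter fun w => isClosed_eq ?_ ?_
      · exact Continuous.matrix_det (continuous_const.sub (hBcont.comp continuous_fst))
      · fun_prop
    have := ((hcomp.inter_right hQ).image continuous_fst).isClosed
    convert this using 1
    ext t
    constructor
    · rintro ⟨ht, r, hr, hrD⟩
      refine ⟨(t, r), ⟨⟨ht, fun i _ => hrD i⟩, fun w => ?_⟩, rfl⟩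
      simp only
      rw [← Matrix.eval_charpoly, hr, Polynomial.eval_prod]
      simp
    · rintro ⟨⟨t', r⟩, ⟨⟨ht, hr⟩, hq⟩, rfl⟩
      refine ⟨ht, r, ?_, fun i => hr i (Set.mem_univ _)⟩
      refine Polynomial.funext fun w => ?_
      rw [Matrix.eval_charpoly, hq w, Polynomial.eval_prod]
      simp
  let G : Set ℝ := Z c
  let H : Set ℝ := ⋃ f ∈ {f : Fin S → Γ.ConnectedComponent |
    ¬ ∃ π : Equiv.Perm (Fin S), ∀ i, f (π i) = c i}, Z f
  have hHclosed : IsClosed H := (Set.toFinite _).isClosed_biUnion fun f _ => hZclosed f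
  have hcover : Set.Icc (0:ℝ) 1 ⊆ G ∪ H := by
    intro t ht
    obtain ⟨r, hr⟩ := exists_rootlist (B t)
    have : ∀ i, ∃ j, ‖r i - z j‖ ≤ ε := by
      intro i
      refine hBF t ht _ ?_
      rw [hr, Polynomial.eval_prod]
      exact Finset.prod_eq_zero (Finset.mem_univ i) (by simp)
    choose g hg using this
    have hrD : ∀ i, r i ∈ D (c (g i)) := by
      intro i
      simp only [D, Set.mem_iUnion, Set.mem_ofPred_eq, Metric.mem_closedBall, dist_eq_norm]
      exact ⟨g i, rfl, hg i⟩
    by_cases hπ : ∃ π : Equiv.Perm (Fin S), ∀ i, c (g (π i)) = c i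
    · left
      obtain ⟨π, hπ⟩ := hπ
      refine ⟨ht, fun i => r (π i), ?_, fun i => ?_⟩
      · rw [hr]
        exact (Equiv.prod_comp π fun i => Polynomial.X - Polynomial.C (r i)).symm
      · rw [← hπ i]; exact hrD _
    · right
      simp only [H, Set.mem_iUnion]
      exact ⟨fun i => c (g i), hπ, ht, r, hr, hrD⟩
  have hdisj : ∀ t, t ∈ G → t ∈ H → False := by
    intro t hG hH
    simp only [H, Set.mem_iUnion] at hH
    obtain ⟨f, hf, -, r', hr', hrD'⟩ := hH
    obtain ⟨-, r, hr, hrD⟩ := hG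
    obtain ⟨π, hπ⟩ := exists_perm_of_prod_eq r r' (by rw [← hr, ← hr'])
    refine hf ⟨π, fun i => hDdisj _ _ (r' (π i)) (hrD' _) ?_⟩
    rw [hπ]; exact hrD i
  have h0G : (0:ℝ) ∈ G := by
    refine ⟨by simp, z, ?_, fun i => ?_⟩
    · simp only [B, Complex.ofReal_zero, zero_smul, add_zero]
      exact Matrix.charpoly_diagonal z
    · simp only [D, Set.mem_iUnion, Set.mem_ofPred_eq]
      exact ⟨i, rfl, Metric.mem_closedBall_self hε⟩
  have h1G : (1:ℝ) ∈ G := by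
    by_contra h1
    have h1H : (1:ℝ) ∈ H := (hcover (by simp)).resolve_left h1
    obtain ⟨t, ht, hG, hH⟩ := isPreconnected_closed_iff.mp isPreconnected_Icc G H (hZclosed c)
      hHclosed hcover ⟨0, by simp, h0G⟩ ⟨1, by simp, h1H⟩
    exact hdisj t hG hH
  obtain ⟨-, r, hr, hrD⟩ := h1G
  obtain ⟨π, hπ⟩ := exists_perm_of_prod_eq r lam (by
    rw [← hr, ← hl]; simp [B])
  refine ⟨π, fun j => ?_⟩
  rw [hπ]
  have hj := hrD j
  simp only [D, Set.mem_iUnion, Set.mem_ofPred_eq, Metric.mem_closedBall, dist_eq_norm] at hj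
  obtain ⟨k, hk, hkr⟩ := hj
  have hwalk : ∀ (a b : Fin S) (w : Γ.Walk a b), ‖z a - z b‖ ≤ w.length * (2 * ε) := by
    intro a b w
    induction w with
    | nil => simp
    | @cons u v x h p ih =>
      rw [SimpleGraph.fromRel_adj] at h
      have h2 : ‖z u - z v‖ ≤ 2 * ε := h.2.elim id (fun h => by rwa [norm_sub_rev])
      rw [SimpleGraph.Walk.length_cons]
      push_cast
      calc ‖z u - z x‖ = ‖(z u - z v) + (z v - z x)‖ := by congr 1; ring
        _ ≤ ‖z u - z v‖ + ‖z v - z x‖ := norm_add_le _ _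
        _ ≤ (p.length + 1) * (2 * ε) := by linarith
  obtain ⟨w⟩ := SimpleGraph.ConnectedComponent.exact hk
  have hlen := w.toPath.2.length_lt
  rw [Fintype.card_fin] at hlen
  have hlen' : ((w.toPath : Γ.Walk k j).length : ℝ) + 1 ≤ S := by exact_mod_cast hlen
  have hw := hwalk k j w.toPath
  calc ‖r j - z j‖ = ‖(r j - z k) + (z k - z j)‖ := by congr 1; ring
    _ ≤ ‖r j - z k‖ + ‖z k - z j‖ := norm_add_le _ _
    _ ≤ 2 * S * ε := by nlinarith

lemma vander_last {S M : ℕ} (hSM : S ≤ M) (z a : Fin S → ℂ) (hz : ∀ j, ‖z j‖ = 1) :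
    ‖∑ j, a j * z j ^ M‖ ^ 2 ≤ (4 ^ S - 1) * ∑ k ∈ Finset.range M, ‖∑ j, a j * z j ^ k‖ ^ 2 := by
  set x : ℕ → ℂ := fun k => ∑ j, a j * z j ^ k with hx
  set f : Polynomial ℂ := ∏ j, (Polynomial.X - Polynomial.C (z j)) with hf
  have hmon : f.Monic := Polynomial.monic_prod_of_monic _ _ fun j _ => Polynomial.monic_X_sub_C _
  have hdeg : f.natDegree = S := by
    rw [hf, Polynomial.natDegree_prod_of_monic _ _ fun j _ => Polynomial.monic_X_sub_C _]
    simp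
  have hcoef : ∀ l, ‖f.coeff l‖ ≤ S.choose l := by
    intro l
    have hroots : f.roots = Finset.univ.val.map z := by
      have := Polynomial.roots_multiset_prod_X_sub_C (Finset.univ.val.map z)
      rw [Multiset.map_map] at this
      exact this
    have := Polynomial.coeff_le_of_roots_le (p := f) (f := RingHom.id ℂ) (B := 1) l hmon
      (IsAlgClosed.splits _) (by
        intro w hw
        rw [Polynomial.map_id, hroots, Multiset.mem_map] at hw
        obtain ⟨j, _, rfl⟩ := hw
        exact (hz j).le)
    rw [Polynomial.map_id, one_pow, one_mul, hdeg] at this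
    exact this
  have hrec : x M = -∑ l ∈ Finset.range S, f.coeff l * x (M - S + l) := by
    have h0 : ∑ l ∈ Finset.range (S + 1), f.coeff l * x (M - S + l) = 0 := by
      simp only [hx, Finset.mul_sum]
      rw [Finset.sum_comm]
      refine Finset.sum_eq_zero fun j _ => ?_
      have hev : f.eval (z j) = 0 := by
        rw [hf, Polynomial.eval_prod]
        exact Finset.prod_eq_zero (Finset.mem_univ j) (by simp)
      rw [Polynomial.eval_eq_sum_range, hdeg] at hev
      calc _ = a j * z j ^ (M - S) * ∑ l ∈ Finset.range (S + 1), f.coeff l * z j ^ l := by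
            rw [Finset.mul_sum]
            refine Finset.sum_congr rfl fun l _ => ?_
            rw [pow_add]; ring
        _ = 0 := by rw [hev, mul_zero]
    rw [Finset.sum_range_succ] at h0
    have hlead : f.coeff S = 1 := by rw [← hdeg]; exact hmon
    rw [hlead, one_mul, Nat.sub_add_cancel hSM] at h0
    linear_combination h0
  set Q := ∑ k ∈ Finset.range M, ‖x k‖ ^ 2 with hQ
  have hQ0 : 0 ≤ Q := Finset.sum_nonneg fun _ _ => sq_nonneg _
  have hxk : ∀ k < M, ‖x k‖ ≤ √Q := by
    intro k hk
    apply Real.le_sqrt_of_sq_le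
    exact Finset.single_le_sum (f := fun k => ‖x k‖ ^ 2) (fun _ _ => sq_nonneg _)
      (Finset.mem_range.mpr hk)
  have hsum : ∑ l ∈ Finset.range S, (S.choose l : ℝ) = 2 ^ S - 1 := by
    have := Nat.sum_range_choose S
    rw [Finset.sum_range_succ, Nat.choose_self] at this
    have h2 : (∑ l ∈ Finset.range S, (S.choose l : ℝ)) + 1 = 2 ^ S := by exact_mod_cast this
    linarith
  have hb : ‖x M‖ ≤ (2 ^ S - 1) * √Q := by
    rw [hrec, norm_neg, ← hsum, Finset.sum_mul]
    refine (norm_sum_le _ _).trans (Finset.sum_le_sum fun l hl => ?_)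
    rw [norm_mul]
    have := Finset.mem_range.mp hl
    exact mul_le_mul (hcoef l) (hxk _ (by omega)) (norm_nonneg _) (by positivity)
  have h1 : (1:ℝ) ≤ 2 ^ S := one_le_pow₀ (by norm_num)
  have h4 : (4:ℝ) ^ S = 2 ^ S * 2 ^ S := by rw [← mul_pow]; norm_num
  calc ‖x M‖ ^ 2 ≤ ((2 ^ S - 1) * √Q) ^ 2 := pow_le_pow_left₀ (norm_nonneg _) hb 2
    _ = (2 ^ S - 1) ^ 2 * Q := by rw [mul_pow, Real.sq_sqrt hQ0]
    _ ≤ (4 ^ S - 1) * Q := by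
      apply mul_le_mul_of_nonneg_right _ hQ0
      rw [h4]; nlinarith

/-- node on the unit circle -/
noncomputable def node {S : ℕ} (ω : Fin S → ℝ) (i : Fin S) : ℂ :=
  Complex.exp (Complex.I * (2 * Real.pi * ω i))

lemma norm_node {S : ℕ} (ω : Fin S → ℝ) (i : Fin S) : ‖node ω i‖ = 1 := by
  unfold node
  rw [mul_comm]; exact_mod_cast Complex.norm_exp_ofReal_mul_I (2 * Real.pi * ω i)

lemma steering_apply {S M : ℕ} (ω : Fin S → ℝ) (k : Fin (M + 1)) (i : Fin S) :
    steering (fun k : Fin (M + 1) => (k : ℤ)) ω k i = node ω i ^ (k : ℕ) := by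
  unfold steering node
  rw [Matrix.of_apply, ← Complex.exp_nat_mul]
  congr 1
  push_cast
  ring

lemma rowsTail_steering {S M : ℕ} (ω : Fin S → ℝ) :
    rowsTail (steering (fun k : Fin (M + 1) => (k : ℤ)) ω) =
      rowsInit (steering (fun k : Fin (M + 1) => (k : ℤ)) ω) * Matrix.diagonal (node ω) := by
  ext k i
  rw [Matrix.mul_diagonal]
  simp only [rowsTail, rowsInit, Matrix.submatrix_apply, id, steering_apply]
  rw [Fin.val_succ, Fin.val_castSucc, pow_succ]

lemma shift_bound {S M : ℕ} (hSM : S ≤ M) (ω : Fin S → ℝ) (c : Fin S → ℂ) :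
    nv (steering (fun k : Fin (M + 1) => (k : ℤ)) ω *ᵥ c) ≤
      2 ^ S * nv (rowsInit (steering (fun k : Fin (M + 1) => (k : ℤ)) ω) *ᵥ c) := by
  refine (sq_le_sq₀ (nv_nonneg _) (mul_nonneg (by positivity) (nv_nonneg _))).mp ?_
  have hv := vander_last hSM (node ω) c (norm_node ω)
  have e1 : ∀ k : Fin (M + 1), (steering (fun k : Fin (M + 1) => (k : ℤ)) ω *ᵥ c) k =
      ∑ j, c j * node ω j ^ (k : ℕ) := by
    intro k
    simp only [Matrix.mulVec, dotProduct, steering_apply, mul_comm]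
  have e2 : ∀ k : Fin M, (rowsInit (steering (fun k : Fin (M + 1) => (k : ℤ)) ω) *ᵥ c) k =
      ∑ j, c j * node ω j ^ (k : ℕ) := fun k => e1 k.castSucc
  have h4 : ((2:ℝ) ^ S) ^ 2 = 4 ^ S := by rw [← pow_mul, mul_comm, pow_mul]; norm_num
  rw [mul_pow, nv_sq, nv_sq, Fin.sum_univ_castSucc, h4]
  simp only [e1, e2, Fin.val_castSucc, Fin.val_last]
  rw [Fin.sum_univ_eq_sum_range (fun k => ‖∑ j, c j * node ω j ^ k‖ ^ 2) M]
  linarith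

lemma steering_upper {S M : ℕ} (ω : Fin S → ℝ) (c : Fin S → ℂ) :
    nv (steering (fun k : Fin (M + 1) => (k : ℤ)) ω *ᵥ c) ≤ √S * √((M : ℝ) + 1) * nv c := by
  refine (sq_le_sq₀ (nv_nonneg _) (mul_nonneg (by positivity) (nv_nonneg _))).mp ?_
  rw [mul_pow, mul_pow, Real.sq_sqrt (by positivity), Real.sq_sqrt (by positivity), nv_sq, nv_sq]
  have : ∀ k : Fin (M + 1), ‖(steering (fun k : Fin (M + 1) => (k : ℤ)) ω *ᵥ c) k‖ ^ 2 ≤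
      S * ∑ i, ‖c i‖ ^ 2 := by
    intro k
    have h1 : ‖(steering (fun k : Fin (M + 1) => (k : ℤ)) ω *ᵥ c) k‖ ≤ ∑ i, ‖c i‖ := by
      simp only [Matrix.mulVec, dotProduct]
      refine (norm_sum_le _ _).trans (Finset.sum_le_sum fun i _ => ?_)
      rw [norm_mul, steering_apply, norm_pow, norm_node, one_pow, one_mul]
    refine (pow_le_pow_left₀ (norm_nonneg _) h1 2).trans ?_
    have := sq_sum_le_card_mul_sum_sq (s := Finset.univ) (f := fun i => ‖c i‖)
    simpa using this
  refine (Finset.sum_le_sum fun k _ => this k).trans ?_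
  simp
  apply le_of_eq; ring

lemma nv_rowsInit {M S : ℕ} (U : Matrix (Fin (M + 1)) (Fin S) ℂ) (c : Fin S → ℂ) :
    nv (rowsInit U *ᵥ c) ≤ nv (U *ᵥ c) := by
  refine (sq_le_sq₀ (nv_nonneg _) (nv_nonneg _)).mp ?_
  rw [nv_sq, nv_sq, Fin.sum_univ_castSucc]
  exact le_add_of_nonneg_right (sq_nonneg _)

lemma nv_rowsTail {M S : ℕ} (U : Matrix (Fin (M + 1)) (Fin S) ℂ) (c : Fin S → ℂ) :
    nv (rowsTail U *ᵥ c) ≤ nv (U *ᵥ c) := by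
  refine (sq_le_sq₀ (nv_nonneg _) (nv_nonneg _)).mp ?_
  rw [nv_sq, nv_sq, Fin.sum_univ_succ (n := M)]
  exact le_add_of_nonneg_left (sq_nonneg _)

/-- the largest Rayleigh quotient is an eigenvalue -/
lemma exists_max_eig {𝕜 E : Type*} [RCLike 𝕜] [NormedAddCommGroup E] [InnerProductSpace 𝕜 E]
    [FiniteDimensional 𝕜 E] [Nontrivial E] (T : E →ₗ[𝕜] E) (hT : T.IsSymmetric) :
    ∃ ν : ℝ, (∃ v : E, v ≠ 0 ∧ T v = (ν : 𝕜) • v) ∧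
      ∀ x, RCLike.re (inner 𝕜 (T x) x) ≤ ν * ‖x‖ ^ 2 := by
  obtain ⟨v, hv⟩ := hT.hasEigenvalue_iSup_of_finiteDimensional.exists_hasEigenvector
  refine ⟨_, ⟨v, hv.2, hv.apply_eq_smul⟩, fun x => ?_⟩
  by_cases hx : x = 0
  · subst hx; simp
  have hbdd : BddAbove (Set.range fun x : { x : E // x ≠ 0 } =>
      RCLike.re (inner 𝕜 (T x) (x : E)) / ‖(x : E)‖ ^ 2) := by
    refine ⟨‖LinearMap.toContinuousLinearMap T‖, ?_⟩
    rintro _ ⟨⟨x, hx⟩, rfl⟩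
    have hp : 0 < ‖x‖ := norm_pos_iff.mpr hx
    simp only
    rw [div_le_iff₀ (by positivity)]
    have h1 : ‖T x‖ ≤ ‖LinearMap.toContinuousLinearMap T‖ * ‖x‖ :=
      (LinearMap.toContinuousLinearMap T).le_opNorm x
    calc RCLike.re (inner 𝕜 (T x) x) ≤ ‖inner 𝕜 (T x) x‖ := RCLike.re_le_norm _
      _ ≤ ‖T x‖ * ‖x‖ := norm_inner_le_norm _ _
      _ ≤ ‖LinearMap.toContinuousLinearMap T‖ * ‖x‖ * ‖x‖ := by gcongr
      _ = _ := by ring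
  have hp : 0 < ‖x‖ := norm_pos_iff.mpr hx
  rw [← div_le_iff₀ (by positivity)]
  exact le_ciSup hbdd ⟨x, hx⟩

/-- Rayleigh bound on the complement of the top eigenspace. -/
lemma rayleigh_compl {N S : ℕ} {T : Matrix (Fin N) (Fin N) ℂ} (hT : T.IsHermitian)
    {U : Matrix (Fin N) (Fin S) ℂ} {μ : Fin S → ℝ}
    (hTU : T * U = U * Matrix.diagonal (fun i => (μ i : ℂ))) (i : Fin S)
    (hmax : ∀ (ν : ℝ) (v : Fin N → ℂ), v ≠ 0 → T.mulVec v = (ν : ℂ) • v →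
      Uᴴ.mulVec v = 0 → ∀ i, ν ≤ μ i) (y : Fin N → ℂ) (hy : Uᴴ *ᵥ y = 0) :
    (star y ⬝ᵥ (T *ᵥ y)).re ≤ μ i * nv y ^ 2 := by
  by_cases hy0 : y = 0
  · subst hy0; simp [nv_zero]
  let K : Submodule ℂ (EuclideanSpace ℂ (Fin N)) := LinearMap.ker (Matrix.toEuclideanLin Uᴴ)
  have memK : ∀ x : EuclideanSpace ℂ (Fin N), x ∈ K ↔ Uᴴ *ᵥ x.ofLp = 0 := by
    intro x
    rw [LinearMap.mem_ker]
    constructor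
    · intro h; exact congrArg WithLp.ofLp h
    · intro h; exact congrArg (WithLp.toLp 2) h
  have hinv : ∀ x ∈ K, Matrix.toEuclideanLin T x ∈ K := by
    intro x hx
    rw [memK] at hx ⊢
    have h1 : Uᴴ * T = Matrix.diagonal (fun i => (μ i : ℂ)) * Uᴴ := by
      have := congrArg conjTranspose hTU
      rw [conjTranspose_mul, conjTranspose_mul, hT.eq, diagonal_conjTranspose] at this
      rw [this]
      congr 2
      ext j; simp
    change Uᴴ *ᵥ (T *ᵥ x.ofLp) = 0
    rw [mulVec_mulVec, h1, ← mulVec_mulVec, hx, mulVec_zero]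
  have hsym := Matrix.isSymmetric_toEuclideanLin_iff.mpr hT
  let TK : K →ₗ[ℂ] K := (Matrix.toEuclideanLin T).restrict hinv
  have hsymK : LinearMap.IsSymmetric (𝕜 := ℂ) (E := K) TK := hsym.restrict_invariant hinv
  let yK : K := ⟨WithLp.toLp 2 y, (memK _).mpr hy⟩
  have hyK : yK ≠ 0 := by
    intro h
    have := congrArg (fun x : K => (x : EuclideanSpace ℂ (Fin N)).ofLp) h
    exact hy0 this
  have : Nontrivial K := ⟨⟨yK, 0, hyK⟩⟩
  have hF : ∀ w : Fin N → ℂ, RCLike.re (inner ℂ (WithLp.toLp 2 (T *ᵥ w) : EuclideanSpace ℂ (Fin N))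
      (WithLp.toLp 2 w)) = (star w ⬝ᵥ (T *ᵥ w)).re := by
    intro w
    rw [EuclideanSpace.inner_toLp_toLp, dotProduct_comm, star_dotProduct]
    simp
  obtain ⟨ν, ⟨v, hv0, hv⟩, hray⟩ := exists_max_eig (𝕜 := ℂ) (E := K) TK hsymK
  have hle : ν ≤ μ i := by
    refine hmax ν (v : EuclideanSpace ℂ (Fin N)).ofLp ?_ ?_ ?_ i
    · intro h
      apply hv0
      apply Subtype.ext
      exact congrArg (WithLp.toLp 2) h
    · exact congrArg (fun x : K => (x : EuclideanSpace ℂ (Fin N)).ofLp) hv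
    · exact (memK _).mp v.2
  have h3 := hray yK
  have hnv : ‖yK‖ = nv y := rfl
  rw [hnv] at h3
  have h4 : (star y ⬝ᵥ (T *ᵥ y)).re ≤ ν * nv y ^ 2 := by
    rw [← hF]; exact h3
  refine h4.trans ?_
  gcongr

lemma rayleigh_top {N S : ℕ} {T : Matrix (Fin N) (Fin N) ℂ} (hT : T.IsHermitian)
    {U : Matrix (Fin N) (Fin S) ℂ} (hU : Uᴴ * U = 1) {μ : Fin S → ℝ}
    (hTU : T * U = U * Matrix.diagonal (fun i => (μ i : ℂ)))
    (hmax : ∀ (ν : ℝ) (v : Fin N → ℂ), v ≠ 0 → T.mulVec v = (ν : ℂ) • v →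
      Uᴴ.mulVec v = 0 → ∀ i, ν ≤ μ i) (i : Fin S) (x : Fin N → ℂ)
    (hx : ∀ j, j ≠ i → (Uᴴ *ᵥ x) j = 0) :
    (star x ⬝ᵥ (T *ᵥ x)).re ≤ μ i * nv x ^ 2 := by
  set w := Uᴴ *ᵥ x with hw
  set y := x - U *ᵥ w with hy
  have hxe : x = U *ᵥ w + y := by rw [hy]; abel
  have hUy : Uᴴ *ᵥ y = 0 := by
    rw [hy, mulVec_sub, mulVec_mulVec, hU, one_mulVec, ← hw, sub_self]
  have hTw : T *ᵥ (U *ᵥ w) = (μ i : ℂ) • (U *ᵥ w) := by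
    rw [mulVec_mulVec, hTU, ← mulVec_mulVec, ← mulVec_smul]
    congr 1
    ext j
    rw [mulVec_diagonal]
    by_cases hj : j = i
    · rw [hj]; simp
    · rw [hx j hj]; simp [hx j hj]
  have hperp : ∀ a : Fin S → ℂ, star (U *ᵥ a) ⬝ᵥ y = 0 := by
    intro a
    rw [star_mulVec, ← dotProduct_mulVec, hUy, dotProduct_zero]
  have hperp' : ∀ a : Fin S → ℂ, star y ⬝ᵥ (U *ᵥ a) = 0 := by
    intro a
    rw [star_dotProduct, hperp, star_zero]
  have hTy : star (U *ᵥ w) ⬝ᵥ (T *ᵥ y) = 0 := by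
    have : star (U *ᵥ w) ⬝ᵥ (T *ᵥ y) = star (T *ᵥ (U *ᵥ w)) ⬝ᵥ y := by
      rw [star_mulVec T, ← dotProduct_mulVec, hT.eq]
    rw [this, hTw, ← mulVec_smul, hperp]
  have hUw : star (U *ᵥ w) ⬝ᵥ (U *ᵥ w) = ((nv w ^ 2 : ℝ) : ℂ) := by
    rw [dot_self, nv_isom hU]
  have hn : nv x ^ 2 = nv w ^ 2 + nv y ^ 2 := by
    have h := dot_self x
    rw [hxe, star_add, add_dotProduct, dotProduct_add, dotProduct_add, hperp, hperp', hUw,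
      dot_self y, ← hxe] at h
    simp only [add_zero, zero_add] at h
    exact_mod_cast h.symm
  have hq : star x ⬝ᵥ (T *ᵥ x) = (μ i : ℂ) * ((nv w ^ 2 : ℝ) : ℂ) + star y ⬝ᵥ (T *ᵥ y) := by
    conv_lhs => rw [hxe]
    rw [star_add, mulVec_add, add_dotProduct, dotProduct_add, dotProduct_add, hTy, hTw,
      dotProduct_smul, dotProduct_smul, hperp', hUw]
    simp
  have hc := rayleigh_compl hT hTU i hmax y hUy
  rw [hq, hn, Complex.add_re, ← Complex.ofReal_mul, Complex.ofReal_re]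
  linarith

section core
variable {N S : ℕ} {A : Matrix (Fin N) (Fin S) ℂ} {σ pm σsq e : ℝ}
  {p : Fin S → ℝ} {That : Matrix (Fin N) (Fin N) ℂ} {U : Matrix (Fin N) (Fin S) ℂ} {μ : Fin S → ℝ}

lemma weyl_lower (hσ : 0 < σ) (hA : ∀ v, σ * nv v ≤ nv (A *ᵥ v)) (hpm : 0 < pm)
    (hp : ∀ i, pm ≤ p i)
    (he : ∀ v, nv ((A * Matrix.diagonal (fun i => (p i : ℂ)) * Aᴴ + (σsq : ℂ) • 1 - That) *ᵥ v)
      ≤ e * nv v)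
    (hT : That.IsHermitian) (hU : Uᴴ * U = 1)
    (hTU : That * U = U * Matrix.diagonal (fun i => (μ i : ℂ)))
    (hmax : ∀ (ν : ℝ) (v : Fin N → ℂ), v ≠ 0 → That.mulVec v = (ν : ℂ) • v →
      Uᴴ.mulVec v = 0 → ∀ i, ν ≤ μ i) (i : Fin S) :
    σsq + pm * σ ^ 2 - e ≤ μ i := by
  obtain ⟨c, hc, hci⟩ : ∃ c : Fin S → ℂ, c ≠ 0 ∧ ∀ j, j ≠ i → (Uᴴ *ᵥ (A *ᵥ c)) j = 0 := by
    by_cases hd : (Uᴴ * A).det = 0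
    · obtain ⟨c, hc, h0⟩ := Matrix.exists_mulVec_eq_zero_iff.mpr hd
      exact ⟨c, hc, fun j _ => by rw [mulVec_mulVec, h0]; rfl⟩
    · have hu : IsUnit (Uᴴ * A).det := isUnit_iff_ne_zero.mpr hd
      have hm : (Uᴴ * A) *ᵥ ((Uᴴ * A)⁻¹ *ᵥ Pi.single i 1) = Pi.single i 1 := by
        rw [mulVec_mulVec, Matrix.mul_nonsing_inv _ hu, one_mulVec]
      refine ⟨(Uᴴ * A)⁻¹ *ᵥ Pi.single i 1, fun h0 => ?_, fun j hj => ?_⟩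
      · rw [h0, mulVec_zero] at hm
        have := congrFun hm i
        simp at this
      · rw [mulVec_mulVec, hm]; simp [hj]
  set x := A *ᵥ c with hx
  have hcp := nv_pos hc
  have hxp : 0 < nv x := lt_of_lt_of_le (by positivity) (hA c)
  have h1 := rayleigh_top hT hU hTU hmax i x hci
  have h2 : σ * nv x ≤ nv (Aᴴ *ᵥ x) := by
    have h := dot_le c (Aᴴ *ᵥ x)
    have h' : star c ⬝ᵥ (Aᴴ *ᵥ x) = star x ⬝ᵥ x := by
      rw [hx, star_mulVec A, ← dotProduct_mulVec]
    rw [h', dot_self, Complex.norm_real, Real.norm_of_nonneg (sq_nonneg _)] at h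
    have hAc := hA c
    have hz := nv_nonneg (Aᴴ *ᵥ x)
    have h5 : nv x * (σ * nv x) ≤ nv x * nv (Aᴴ *ᵥ x) := by nlinarith
    exact le_of_mul_le_mul_left h5 hxp
  have h3 : (star x ⬝ᵥ ((A * Matrix.diagonal (fun i => (p i : ℂ)) * Aᴴ) *ᵥ x)).re ≥
      pm * nv (Aᴴ *ᵥ x) ^ 2 := by
    rw [← mulVec_mulVec, ← mulVec_mulVec]
    have : star x ⬝ᵥ (A *ᵥ (Matrix.diagonal (fun i => (p i : ℂ)) *ᵥ (Aᴴ *ᵥ x))) =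
        star (Aᴴ *ᵥ x) ⬝ᵥ (Matrix.diagonal (fun i => (p i : ℂ)) *ᵥ (Aᴴ *ᵥ x)) := by
      rw [star_mulVec Aᴴ, ← dotProduct_mulVec, conjTranspose_conjTranspose]
    rw [this]
    set g := Aᴴ *ᵥ x
    have hg : star g ⬝ᵥ (Matrix.diagonal (fun i => (p i : ℂ)) *ᵥ g) =
        ((∑ j, p j * ‖g j‖ ^ 2 : ℝ) : ℂ) := by
      simp only [dotProduct, mulVec_diagonal, Pi.star_apply, RCLike.star_def]
      push_cast
      refine Finset.sum_congr rfl fun j _ => ?_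
      rw [← Complex.conj_mul']; ring
    rw [hg, Complex.ofReal_re, nv_sq, Finset.mul_sum]
    exact Finset.sum_le_sum fun j _ => mul_le_mul_of_nonneg_right (hp j) (sq_nonneg _)
  have h4 : (star x ⬝ᵥ ((A * Matrix.diagonal (fun i => (p i : ℂ)) * Aᴴ + (σsq : ℂ) • 1 - That)
      *ᵥ x)).re ≤ e * nv x ^ 2 := by
    refine (Complex.re_le_norm _).trans ((dot_le _ _).trans ?_)
    nlinarith [he x]
  rw [sub_mulVec, add_mulVec, dotProduct_sub, dotProduct_add, smul_mulVec, one_mulVec,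
    dotProduct_smul, dot_self, Complex.sub_re, Complex.add_re, smul_eq_mul, ← Complex.ofReal_mul,
    Complex.ofReal_re] at h4
  have h6 : (σ * nv x) ^ 2 ≤ nv (Aᴴ *ᵥ x) ^ 2 := pow_le_pow_left₀ (by positivity) h2 2
  have h7 : pm * (σ * nv x) ^ 2 ≤ pm * nv (Aᴴ *ᵥ x) ^ 2 := by gcongr
  have h8 : (σsq + pm * σ ^ 2 - e) * nv x ^ 2 ≤ μ i * nv x ^ 2 := by nlinarith
  exact le_of_mul_le_mul_right h8 (by positivity)

lemma sin_theta (hσ : 0 < σ) (hA : ∀ v, σ * nv v ≤ nv (A *ᵥ v)) (he0 : 0 ≤ e)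
    (he : ∀ v, nv ((A * Matrix.diagonal (fun i => (p i : ℂ)) * Aᴴ + (σsq : ℂ) • 1 - That) *ᵥ v)
      ≤ e * nv v)
    (hU : Uᴴ * U = 1)
    (hTU : That * U = U * Matrix.diagonal (fun i => (μ i : ℂ))) {g : ℝ} (hg : 0 < g)
    (hμ : ∀ i, σsq + g ≤ μ i) (v : Fin S → ℂ) :
    nv (((1 - A * pinv A) * U) *ᵥ v) ≤ e / g * nv v := by
  set E := A * Matrix.diagonal (fun i => (p i : ℂ)) * Aᴴ + (σsq : ℂ) • 1 - That with hE
  set Q := 1 - A * pinv A with hQ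
  have hQA : Q * A = 0 := by
    rw [hQ, Matrix.sub_mul, Matrix.mul_assoc, pinv_mul hσ hA]; simp
  let u : Fin S → ℂ := fun i => v i / ((μ i - σsq : ℝ) : ℂ)
  have hpos : ∀ i, g ≤ μ i - σsq := fun i => by linarith [hμ i]
  have hvu : v = Matrix.diagonal (fun i => (μ i : ℂ)) *ᵥ u - (σsq : ℂ) • u := by
    ext i
    have : (μ i : ℂ) - σsq ≠ 0 := by
      have := (lt_of_lt_of_le hg (hpos i)).ne'
      exact_mod_cast this
    simp only [Pi.sub_apply, mulVec_diagonal, Pi.smul_apply, smul_eq_mul, u]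
    push_cast
    field_simp
  have hmain : (Q * U) *ᵥ v = - (Q *ᵥ (E *ᵥ (U *ᵥ u))) := by
    rw [hvu, mulVec_sub, mulVec_mulVec, Matrix.mul_assoc, ← hTU]
    have hTh : That = A * Matrix.diagonal (fun i => (p i : ℂ)) * Aᴴ + (σsq : ℂ) • 1 - E := by
      rw [hE]; abel
    have hQT : Q * That = (σsq : ℂ) • Q - Q * E := by
      rw [hTh, Matrix.mul_sub, Matrix.mul_add, ← Matrix.mul_assoc, ← Matrix.mul_assoc, hQA]
      simp
    rw [← Matrix.mul_assoc, hQT, Matrix.sub_mul, sub_mulVec, mulVec_smul, Matrix.smul_mul,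
      smul_mulVec]
    simp only [mulVec_mulVec, Matrix.mul_assoc]
    abel
  have hu : nv u ≤ nv v / g := by
    rw [le_div_iff₀ hg]
    refine (sq_le_sq₀ (mul_nonneg (nv_nonneg _) hg.le) (nv_nonneg _)).mp ?_
    rw [mul_pow, nv_sq, nv_sq, Finset.sum_mul]
    refine Finset.sum_le_sum fun i _ => ?_
    have h1 := hpos i
    have h2 : 0 < μ i - σsq := lt_of_lt_of_le hg h1
    have : ‖v i‖ = ‖u i‖ * (μ i - σsq) := by
      simp only [u]
      rw [norm_div, Complex.norm_real, Real.norm_of_nonneg h2.le]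
      field_simp
    rw [this, mul_pow]
    gcongr
  have hneg : ∀ a : Fin N → ℂ, nv (-a) = nv a := by
    intro a; unfold nv; rw [WithLp.toLp_neg, norm_neg]
  rw [hmain, hneg]
  calc _ ≤ nv (E *ᵥ (U *ᵥ u)) := nv_perp hσ hA _
    _ ≤ e * nv (U *ᵥ u) := he _
    _ = e * nv u := by rw [nv_isom hU]
    _ ≤ e * (nv v / g) := by gcongr
    _ = _ := by ring

end core

lemma esprit_pert {S M : ℕ} (hSM : S ≤ M) (ω : Fin S → ℝ) (U : Matrix (Fin (M + 1)) (Fin S) ℂ)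
    (hU : Uᴴ * U = 1) {σ s : ℝ} (hσ : 0 < σ) (hs0 : 0 ≤ s) (hs1 : s ≤ 1 / 10)
    (hs2 : s * 2 ^ S ≤ 1 / 5) (lam : Fin S → ℂ) (hl : IsEigList (espritMat U) lam)
    (A : Matrix (Fin (M + 1)) (Fin S) ℂ) (hAdef : A = steering (fun k : Fin (M + 1) => (k : ℤ)) ω)
    (hA : ∀ v, σ * nv v ≤ nv (A *ᵥ v))
    (hR : ∀ v, nv (((1 - A * pinv A) * U) *ᵥ v) ≤ s * nv v) :
    ∃ π : Equiv.Perm (Fin S), ∀ j, ‖lam (π j) - node ω j‖ ≤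
      2 * S * (4 * 2 ^ S * (√S * √((M : ℝ) + 1)) * s / σ) := by
  set R := (1 - A * pinv A) * U with hRdef
  set G := pinv A * U with hG
  have hUeq : U = A * G + R := by
    rw [hRdef, hG, Matrix.sub_mul, Matrix.one_mul, Matrix.mul_assoc]; abel
  have hW : ∀ v, nv ((A * G) *ᵥ v) ≤ (11 / 10) * nv v := by
    intro v
    have h1 : (A * G) *ᵥ v = U *ᵥ v - R *ᵥ v := by
      rw [← sub_mulVec]; congr 1; rw [eq_sub_iff_add_eq]; exact hUeq.symm
    rw [h1]
    have h2 := nv_sub_le (U *ᵥ v) (R *ᵥ v)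
    rw [nv_isom hU] at h2
    nlinarith [hR v, nv_nonneg v]
  have hWl : ∀ v, (9 / 10) * nv v ≤ nv ((A * G) *ᵥ v) := by
    intro v
    have h2 := nv_add_le ((A * G) *ᵥ v) (R *ᵥ v)
    rw [← add_mulVec, ← hUeq, nv_isom hU] at h2
    nlinarith [hR v, nv_nonneg v]
  have hGdet : IsUnit G.det := by
    refine det_unit_of_lower fun v hv => ?_
    have := hWl v
    rw [← mulVec_mulVec, hv, mulVec_zero, nv_zero] at this
    exact nv_eq_zero (by linarith)
  have hGup : ∀ v, nv (G *ᵥ v) ≤ (11 / 10) / σ * nv v := by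
    intro v
    have h1 := hA (G *ᵥ v)
    rw [mulVec_mulVec] at h1
    have h2 := h1.trans (hW v)
    rw [div_mul_eq_mul_div, le_div_iff₀ hσ]
    linarith
  set L := √S * √((M : ℝ) + 1) with hL
  have hL0 : 0 ≤ L := by positivity
  have hGinv : ∀ v, nv (G⁻¹ *ᵥ v) ≤ (10 / 9) * L * nv v := by
    intro v
    have h1 := hWl (G⁻¹ *ᵥ v)
    rw [mulVec_mulVec, Matrix.mul_assoc, Matrix.mul_nonsing_inv _ hGdet, Matrix.mul_one] at h1
    have h2 : nv (A *ᵥ v) ≤ L * nv v := by rw [hAdef]; exact steering_upper ω v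
    linarith
  have h2S : (0:ℝ) < 2 ^ S := by positivity
  have hU0 : ∀ v, (7 / 10) / 2 ^ S * nv v ≤ nv (rowsInit U *ᵥ v) := by
    intro v
    have e1 : rowsInit U *ᵥ v + (-(rowsInit R)) *ᵥ v = rowsInit A *ᵥ (G *ᵥ v) := by
      rw [← add_mulVec, mulVec_mulVec]
      congr 1
      conv_lhs => rw [hUeq]
      have : rowsInit (A * G + R) = rowsInit A * G + rowsInit R := rfl
      rw [this]; abel
    have h1 := nv_sub_le (rowsInit U *ᵥ v) (rowsInit R *ᵥ v)
    rw [sub_eq_add_neg, ← neg_mulVec, e1] at h1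
    have h2 := (nv_rowsInit R v).trans (hR v)
    have h3 : nv (A *ᵥ (G *ᵥ v)) ≤ 2 ^ S * nv (rowsInit A *ᵥ (G *ᵥ v)) := by
      rw [hAdef]; exact shift_bound hSM ω _
    have h4 := hWl v
    rw [← mulVec_mulVec] at h4
    rw [div_mul_eq_mul_div, div_le_iff₀ h2S]
    have h5 : 2 ^ S * nv (rowsInit A *ᵥ (G *ᵥ v)) ≤ 2 ^ S * (nv (rowsInit U *ᵥ v) + s * nv v) := by
      gcongr; linarith
    have h6 : s * 2 ^ S * nv v ≤ 1 / 5 * nv v := mul_le_mul_of_nonneg_right hs2 (nv_nonneg v)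
    linarith
  have hκ : (0:ℝ) < (7 / 10) / 2 ^ S := by positivity
  have hpi := pinv_mul hκ hU0
  have hpb := pinv_bound hκ hU0
  set Λ := Matrix.diagonal (node ω) with hΛ
  set F := rowsTail R * G⁻¹ - rowsInit R * G⁻¹ * Λ with hF
  have hident : G * espritMat U * G⁻¹ = Λ + G * pinv (rowsInit U) * F := by
    have e1 : rowsTail U = rowsInit A * Λ * G + rowsTail R := by
      conv_lhs => rw [hUeq]
      have : rowsTail (A * G + R) = rowsTail A * G + rowsTail R := rfl
      rw [this, hAdef, rowsTail_steering]
    have e0 : rowsInit U = rowsInit A * G + rowsInit R := by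
      conv_lhs => rw [hUeq]
      rfl
    have e2 : rowsInit A = (rowsInit U - rowsInit R) * G⁻¹ := by
      rw [e0, add_sub_cancel_right, Matrix.mul_assoc, Matrix.mul_nonsing_inv _ hGdet,
        Matrix.mul_one]
    have e3 : rowsTail U * G⁻¹ = rowsInit U * (G⁻¹ * Λ) + F := by
      rw [e1, Matrix.add_mul, Matrix.mul_assoc _ G, Matrix.mul_nonsing_inv _ hGdet, Matrix.mul_one,
        e2, hF, Matrix.sub_mul, Matrix.sub_mul, Matrix.mul_assoc (rowsInit U)]
      abel
    have e4 : espritMat U * G⁻¹ = G⁻¹ * Λ + pinv (rowsInit U) * F := by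
      unfold espritMat
      rw [Matrix.mul_assoc (pinv (rowsInit U)) (rowsTail U) G⁻¹, e3, Matrix.mul_add,
        ← Matrix.mul_assoc (pinv (rowsInit U)) (rowsInit U) (G⁻¹ * Λ), hpi, Matrix.one_mul]
    rw [Matrix.mul_assoc G (espritMat U) G⁻¹, e4, Matrix.mul_add, ← Matrix.mul_assoc G G⁻¹ Λ,
      Matrix.mul_nonsing_inv _ hGdet, Matrix.one_mul, ← Matrix.mul_assoc G (pinv (rowsInit U)) F]
  have hΛn : ∀ v, nv (Λ *ᵥ v) = nv v := by
    intro v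
    refine (sq_eq_sq₀ (nv_nonneg _) (nv_nonneg _)).mp ?_
    rw [nv_sq, nv_sq]
    refine Finset.sum_congr rfl fun i _ => ?_
    rw [hΛ, mulVec_diagonal, norm_mul, norm_node, one_mul]
  have hFb : ∀ v, nv (F *ᵥ v) ≤ 2 * s * ((10 / 9) * L) * nv v := by
    intro v
    rw [hF, sub_mulVec, ← mulVec_mulVec, ← mulVec_mulVec, ← mulVec_mulVec]
    have h1 := (nv_rowsTail R (G⁻¹ *ᵥ v)).trans (hR _)
    have h2 := (nv_rowsInit R (G⁻¹ *ᵥ (Λ *ᵥ v))).trans (hR _)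
    have h3 := hGinv v
    have h4 := hGinv (Λ *ᵥ v)
    rw [hΛn] at h4
    have h5 := mul_le_mul_of_nonneg_left h3 hs0
    have h6 := mul_le_mul_of_nonneg_left h4 hs0
    refine (nv_sub_le _ _).trans ?_
    linarith
  refine eig_matching (node ω) (G * pinv (rowsInit U) * F) (by positivity) (fun v => ?_) lam ?_
  · rw [← mulVec_mulVec, ← mulVec_mulVec]
    have h1 := hGup (pinv (rowsInit U) *ᵥ (F *ᵥ v))
    have h2 := hpb (F *ᵥ v)
    rw [div_mul_eq_mul_div, div_le_iff₀ h2S] at h2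
    have h3 : nv (pinv (rowsInit U) *ᵥ (F *ᵥ v)) ≤ 10 / 7 * 2 ^ S * (2 * s * ((10 / 9) * L) * nv v) := by
      have := mul_le_mul_of_nonneg_left (hFb v) h2S.le
      linarith
    refine h1.trans ((mul_le_mul_of_nonneg_left h3 (by positivity)).trans ?_)
    have hv := nv_nonneg v
    have : (11 / 10) / σ * (10 / 7 * 2 ^ S * (2 * s * ((10 / 9) * L) * nv v)) =
        (220 / 63) * (2 ^ S * L * s / σ * nv v) := by ring
    rw [this]
    have h0 : 0 ≤ 2 ^ S * L * s / σ * nv v := by positivity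
    calc _ ≤ 4 * (2 ^ S * L * s / σ * nv v) := by linarith
      _ = _ := by ring
  · rw [← hΛ, ← hident, Matrix.charpoly_mul_comm, ← Matrix.mul_assoc,
      Matrix.nonsing_inv_mul _ hGdet, Matrix.one_mul]
    exact hl

/-- **Theorem 2 (deterministic error bound for Coarray ESPRIT).** If `β > 0` and
`‖E_L‖₂ ≤ C_S β`, then the Coarray ESPRIT estimates computed from `T̂_ca` satisfy
`md(ω, ω̂) ≤ q ‖E_L‖₂` with `q = C_S' √(M_ca+1)/(β σ_S(A_U(ω)))`. -/
theorem coarray_esprit_deterministic_error_bound {P S Mca : ℕ} (d : Fin P → ℤ)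
    (hd : Function.Injective d) (hhf : HoleFree d Mca)
    (hS : 1 ≤ S) (hSM : S ≤ Mca)
    (ω : Fin S → ℝ) (hdis : Function.Injective ω) (hω01 : ∀ i, ω i ∈ Set.Ico (0 : ℝ) 1)
    (p : Fin S → ℝ) (hp : ∀ i, 0 < p i) (σsq : ℝ) (hσ : 0 ≤ σsq)
    (That : Matrix (Fin (Mca + 1)) (Fin (Mca + 1)) ℂ) (hThat : That.IsHermitian) :
    let AU := steering (fun k : Fin (Mca + 1) => (k : ℤ)) ω
    let Tca := AU * Matrix.diagonal (fun i => (p i : ℂ)) * AUᴴ + (σsq : ℂ) • 1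
    let EL := Tca - That
    let β := (⨅ i, p i) * sval AU S ^ 2 - σsq
    let CS : ℝ := 1 / ((2 : ℝ) ^ S * 4 * Real.sqrt 2)
    let CS' : ℝ := 14 * Real.sqrt 2 * Real.pi * ((S : ℝ) * Real.sqrt S) * 4 ^ S
    let q := CS' * Real.sqrt ((Mca : ℝ) + 1) / (β * sval AU S)
    0 < β → specNorm EL ≤ CS * β →
    ∀ Uh : Matrix (Fin (Mca + 1)) (Fin S) ℂ, IsTopEigenbasis That Uh →
    ∀ lam : Fin S → ℂ, IsEigList (espritMat Uh) lam →
    mdist ω (fun i => (lam i).arg / (2 * Real.pi)) ≤ q * specNorm EL := by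
  intro AU Tca EL β CS CS' q hβ hEL Uh hUh lam hlam
  have hne : Nonempty (Fin S) := ⟨⟨0, hS⟩⟩
  set σ := sval AU S with hσdef
  set pm := ⨅ i, p i with hpm
  set e := specNorm EL with he
  have he0 : 0 ≤ e := sn_nonneg _
  have hpmi : ∀ i, pm ≤ p i := fun i => ciInf_le (Set.finite_range _).bddBelow i
  have hσ0 : 0 ≤ σ := sval_nonneg _ _
  have hβdef : β = pm * σ ^ 2 - σsq := rfl
  have hδpos : 0 < pm * σ ^ 2 := by linarith
  have hσpos : 0 < σ := by
    rcases hσ0.lt_or_eq with h | h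
    · exact h
    · rw [← h] at hδpos; simp at hδpos
  have hpmpos : 0 < pm := by
    by_contra h
    push Not at h
    nlinarith [sq_nonneg σ]
  set δ := pm * σ ^ 2 with hδ
  have hβδ : β ≤ δ := by linarith
  have hA : ∀ v, σ * nv v ≤ nv (AU *ᵥ v) := fun v => sval_le AU v
  have h2S : (2:ℝ) ≤ 2 ^ S := by
    calc (2:ℝ) = 2 ^ 1 := by norm_num
      _ ≤ 2 ^ S := pow_le_pow_right₀ (by norm_num) hS
  have hs2 : (1.41:ℝ) ≤ √2 := by
    apply Real.le_sqrt_of_sq_le; norm_num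
  have hCS : e * 2 ^ S * 5.64 ≤ β := by
    have hCSd : CS = 1 / ((2 : ℝ) ^ S * 4 * √2) := rfl
    rw [hCSd, div_mul_eq_mul_div, le_div_iff₀ (by positivity), one_mul] at hEL
    have h0 : 0 ≤ e * 2 ^ S := by positivity
    nlinarith [mul_le_mul_of_nonneg_left hs2 h0]
  have heδ : e * 11.28 ≤ δ := by
    nlinarith [mul_le_mul_of_nonneg_left h2S he0]
  have hg : 0 < δ - e := by linarith
  obtain ⟨hU, μ, hTU, hmax⟩ := hUh
  have hEb : ∀ v, nv ((AU * Matrix.diagonal (fun i => (p i : ℂ)) * AUᴴ + (σsq : ℂ) • 1 - That) *ᵥ v)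
      ≤ e * nv v := fun v => sn_mulVec EL v
  have hμ : ∀ i, σsq + (δ - e) ≤ μ i := fun i => by
    have := weyl_lower hσpos hA hpmpos hpmi hEb hThat hU hTU hmax i
    linarith
  have hR := sin_theta hσpos hA he0 hEb hU hTU hg hμ
  set s := e / (δ - e) with hs
  have hs0 : 0 ≤ s := by positivity
  have hsle : s ≤ 1.1 * e / δ := by
    rw [hs, div_le_div_iff₀ hg hδpos]
    nlinarith
  have hs1 : s ≤ 1 / 10 := by
    rw [hs, div_le_iff₀ hg]; linarith
  have hs3 : s * 2 ^ S ≤ 1 / 5 := by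
    have h1 : s * 2 ^ S ≤ 1.1 * e / δ * 2 ^ S := by gcongr
    refine h1.trans ?_
    rw [div_mul_eq_mul_div, div_le_iff₀ hδpos]
    linarith
  obtain ⟨π, hπ⟩ := esprit_pert hSM ω Uh hU hσpos hs0 hs1 hs3 lam hlam AU rfl hA hR
  have hfin : S * (4 * 2 ^ S * (√S * √((Mca : ℝ) + 1)) * s / σ) ≤ q * e := by
    set L := √S * √((Mca : ℝ) + 1) with hL
    have hL0 : 0 ≤ L := by positivity
    have hq : q * e = 14 * √2 * Real.pi * 4 ^ S * (S * L * (e / (β * σ))) := by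
      simp only [q, CS', hL]; ring
    have h1 : s / σ ≤ 1.1 * (e / (β * σ)) := by
      have h2 : s ≤ 1.1 * e / β := hsle.trans (by gcongr)
      calc s / σ ≤ 1.1 * e / β / σ := by gcongr
        _ = _ := by rw [div_div]; ring
    have hX : 0 ≤ S * L * (e / (β * σ)) := by positivity
    have h24 : (2:ℝ) ^ S ≤ 4 ^ S := by gcongr; norm_num
    calc S * (4 * 2 ^ S * L * s / σ) = 4 * 2 ^ S * (S * L * (s / σ)) := by ring
      _ ≤ 4 * 2 ^ S * (S * L * (1.1 * (e / (β * σ)))) := by gcongr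
      _ = 4.4 * 2 ^ S * (S * L * (e / (β * σ))) := by ring
      _ ≤ 14 * √2 * Real.pi * 4 ^ S * (S * L * (e / (β * σ))) := by
        gcongr
        nlinarith [Real.pi_gt_three, mul_le_mul hs2 Real.pi_gt_three.le (by norm_num) (by positivity)]
      _ = q * e := hq.symm
  refine (ciInf_le (Set.finite_range _).bddBelow π).trans (ciSup_le fun j => ?_)
  obtain ⟨k, hk⟩ := arg_bound (ω j) (lam (π j))
  refine (ciInf_le ⟨0, ?_⟩ k).trans (hk.trans ?_)
  · rintro _ ⟨k, rfl⟩; exact abs_nonneg _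
  · have := hπ j
    unfold node at this
    linarith
end

section
/- Smallest singular value of a well-separated Vandermonde matrix: Let K ≥ S ≥ 1 and let V(α) ∈ ℂ^{K×S} be the Vandermonde matrix with entries [V(α)]_{m,n} = e^{i2π(m−1)α_n}, where α₁, …, α_S ∈ [0,1) are distinct. If for some constant γ > 1 the wrap-around separation satisfies min_{i≠j} min_{k∈ℤ} |α_i − α_j + k| ≥ γ/K, then σ_S(V(α))² ≥ K/C′ where C′ = γ/(γ−1). -/
open Matrix

noncomputable section

/-- Vandermonde matrix with unit-modulus nodes: entries `e^{i2π(m−1)α_n}`. -/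
def vandermonde (K S : ℕ) (α : Fin S → ℝ) : Matrix (Fin K) (Fin S) ℂ :=
  Matrix.of fun m n => Complex.exp (Complex.I * (2 * Real.pi * (m : ℕ) * α n))

end


lemma aux_sin (y : ℝ) (hy : 0 ≤ y) : y - y^3/6 ≤ Real.sin y :=
  Real.sin_ge_sub_cube hy

lemma aux_cos (y : ℝ) (hy : 0 ≤ y) : Real.cos y ≤ 1 - y^2/2 + y^4/24 := by
  have h : MonotoneOn (fun y : ℝ => (1 - y^2/2 + y^4/24) - Real.cos y) (Set.Ici 0) := by
    apply monotoneOn_of_deriv_nonneg (convex_Ici 0)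
    · fun_prop
    · fun_prop
    · intro x hx
      have : HasDerivAt (fun y : ℝ => (1 - y^2/2 + y^4/24) - Real.cos y) (-x + x^3/6 + Real.sin x) x := by
        have h2 := (hasDerivAt_pow 2 x).div_const 2
        have h4 := (hasDerivAt_pow 4 x).div_const 24
        refine HasDerivAt.congr_deriv
          (((((hasDerivAt_const x (1:ℝ)).sub h2).add h4)).sub (Real.hasDerivAt_cos x)) ?_
        norm_num; ring
      rw [this.deriv]
      have := aux_sin x (by simpa using (interior_subset hx))
      linarith
  have := h (Set.mem_Ici.2 le_rfl) (Set.mem_Ici.2 hy) hy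
  simp at this
  linarith

lemma aux_trig0 (y : ℝ) (hy : 0 ≤ y) (hy2 : y ≤ Real.pi / 2) :
    y^2 * (1 + 2 * Real.cos y) ≤ 3 * Real.sin y ^ 2 := by
  have h1 := aux_sin y hy
  have h2 := aux_cos y hy
  have hy3 : y ≤ 2 := by have := Real.pi_le_four; linarith
  have h0 : 0 ≤ y - y^3/6 := by
    have : 0 ≤ y * (6 - y^2) := mul_nonneg hy (by nlinarith)
    nlinarith
  have h3 := pow_le_pow_left₀ h0 h1 2
  nlinarith [mul_le_mul_of_nonneg_left h2 (sq_nonneg y)]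

/-- pointwise bound, all real θ with a representative t -/
lemma aux_trig (θ t : ℝ) (k : ℤ) (hk : θ = t + k) (ht : |t| ≤ 1/2) (ht0 : t ≠ 0) :
    ((Real.sin (Real.pi * θ))⁻¹)^2 + 2 * |(Real.sin (Real.pi * θ))⁻¹ *
      (Real.cos (Real.pi * θ) * (Real.sin (Real.pi * θ))⁻¹)| ≤ 3 / Real.pi^2 * (1 / t^2) := by
  have hpi := Real.pi_pos
  have hs : Real.sin (Real.pi * θ) ^ 2 = Real.sin (Real.pi * |t|) ^ 2 := by
    have : Real.sin (Real.pi * θ) = (-1)^k * Real.sin (Real.pi * t) := by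
      rw [hk, mul_add, mul_comm Real.pi (k:ℝ), Real.sin_add_int_mul_pi]
    rw [this, mul_pow]
    have h1 : (((-1:ℝ))^k)^2 = 1 := by
      rw [← zpow_natCast, ← _root_.zpow_mul, mul_comm, _root_.zpow_mul]; simp
    rw [h1, one_mul]
    rcases abs_cases t with ⟨h, _⟩ | ⟨h, _⟩ <;> simp [h]
  have hc : |Real.cos (Real.pi * θ)| = Real.cos (Real.pi * |t|) := by
    have : Real.cos (Real.pi * θ) = (-1)^k * Real.cos (Real.pi * t) := by
      rw [hk, mul_add, mul_comm Real.pi (k:ℝ), Real.cos_add_int_mul_pi]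
    rw [this, abs_mul, abs_zpow, abs_neg, abs_one, _root_.one_zpow, one_mul]
    have h2 : Real.cos (Real.pi * t) = Real.cos (Real.pi * |t|) := by
      rcases abs_cases t with ⟨h, _⟩ | ⟨h, _⟩ <;> simp [h]
    rw [h2]
    apply abs_of_nonneg
    apply Real.cos_nonneg_of_neg_pi_div_two_le_of_le <;> nlinarith [abs_nonneg t]
  have htp : 0 < |t| := abs_pos.2 ht0
  have hsp : 0 < Real.sin (Real.pi * |t|) := by
    apply Real.sin_pos_of_pos_of_lt_pi <;> nlinarith
  have key := aux_trig0 (Real.pi * |t|) (by positivity) (by nlinarith)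
  have e : ((Real.sin (Real.pi * θ))⁻¹)^2 + 2 * |(Real.sin (Real.pi * θ))⁻¹ *
      (Real.cos (Real.pi * θ) * (Real.sin (Real.pi * θ))⁻¹)| =
      (1 + 2 * Real.cos (Real.pi * |t|)) / Real.sin (Real.pi * |t|) ^ 2 := by
    have : (Real.sin (Real.pi * θ))⁻¹ *
      (Real.cos (Real.pi * θ) * (Real.sin (Real.pi * θ))⁻¹) =
      Real.cos (Real.pi * θ) / (Real.sin (Real.pi * θ))^2 := by
      rw [div_eq_mul_inv, sq, mul_inv]; ring
    rw [this, abs_div, hc, abs_of_nonneg (sq_nonneg (Real.sin _)), inv_pow, hs]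
    ring
  rw [e, div_mul_div_comm, div_le_div_iff₀ (by positivity) (by positivity)]
  rw [← sq_abs t]
  nlinarith

lemma aux_sum {ι : Type*} (T : Finset ι) (t : ι → ℝ) (δ : ℝ) (hδ : 0 < δ)
    (h1 : ∀ i ∈ T, δ ≤ t i) (h2 : ∀ i ∈ T, ∀ j ∈ T, i ≠ j → δ ≤ |t i - t j|) :
    ∑ i ∈ T, 1 / (t i)^2 ≤ Real.pi^2/6 / δ^2 := by
  classical
  have hf : ∀ i ∈ T, 1 ≤ ⌊t i / δ⌋₊ := fun i hi => by
    rw [Nat.one_le_floor_iff, le_div_iff₀ hδ]; linarith [h1 i hi]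
  have hle : ∀ i ∈ T, (⌊t i / δ⌋₊ : ℝ) * δ ≤ t i := fun i hi => by
    rw [← le_div_iff₀ hδ]
    exact Nat.floor_le (div_nonneg (hδ.le.trans (h1 i hi)) hδ.le)
  have hlt : ∀ i ∈ T, t i < (⌊t i / δ⌋₊ + 1 : ℝ) * δ := fun i hi => by
    rw [← div_lt_iff₀ hδ]
    exact Nat.lt_floor_add_one _
  have hinj : Set.InjOn (fun i => ⌊t i / δ⌋₊) T := by
    intro i hi j hj hij
    by_contra hne
    have := h2 i hi j hj hne
    have a := hle i hi
    have b := hle j hj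
    have c := hlt i hi
    have d := hlt j hj
    simp only at hij
    rw [hij] at a c
    have : |t i - t j| < δ := by rw [abs_lt]; constructor <;> linarith
    linarith
  calc ∑ i ∈ T, 1 / (t i)^2 ≤ ∑ i ∈ T, (1 / ((⌊t i / δ⌋₊ : ℕ):ℝ)^2) / δ^2 := by
        apply Finset.sum_le_sum
        intro i hi
        have : (1:ℝ) ≤ ⌊t i / δ⌋₊ := by exact_mod_cast hf i hi
        rw [div_div, ← mul_pow]
        apply one_div_le_one_div_of_le (by positivity)
        exact pow_le_pow_left₀ (by positivity) (hle i hi) 2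
    _ = (∑ k ∈ T.image (fun i => ⌊t i / δ⌋₊), (1 / (k:ℝ)^2)) / δ^2 := by
        rw [Finset.sum_image hinj, Finset.sum_div]
    _ ≤ Real.pi^2/6 / δ^2 := by
        gcongr
        exact sum_le_hasSum _ (fun i _ => by positivity) hasSum_zeta_two

lemma aux_sum2 {ι : Type*} (T : Finset ι) (t : ι → ℝ) (δ : ℝ) (hδ : 0 < δ)
    (h1 : ∀ i ∈ T, δ ≤ |t i|) (h2 : ∀ i ∈ T, ∀ j ∈ T, i ≠ j → δ ≤ |t i - t j|) :
    ∑ i ∈ T, 1 / (t i)^2 ≤ Real.pi^2/3 / δ^2 := by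
  rw [← Finset.sum_filter_add_sum_filter_not T (fun i => 0 < t i)]
  have a := aux_sum (T.filter (fun i => 0 < t i)) t δ hδ
    (fun i hi => by
      rw [Finset.mem_filter] at hi
      simpa [abs_of_pos hi.2] using h1 i hi.1)
    (fun i hi j hj => h2 i (Finset.mem_filter.1 hi).1 j (Finset.mem_filter.1 hj).1)
  have b := aux_sum (T.filter (fun i => ¬ 0 < t i)) (fun i => - t i) δ hδ
    (fun i hi => by
      rw [Finset.mem_filter] at hi
      simpa [abs_of_nonpos (not_lt.1 hi.2)] using h1 i hi.1)
    (fun i hi j hj h => by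
      have := h2 i (Finset.mem_filter.1 hi).1 j (Finset.mem_filter.1 hj).1 h
      rwa [← abs_neg, show -(-t i - -t j) = t i - t j by ring])
  simp only [neg_sq] at b
  have : Real.pi^2/3/δ^2 = Real.pi^2/6/δ^2 + Real.pi^2/6/δ^2 := by ring
  linarith

lemma aux_id (x y : ℝ) (hx : Real.sin x ≠ 0) (hy : Real.sin y ≠ 0) (hxy : Real.sin (x - y) ≠ 0) :
    (Real.sin x)⁻¹ * (Real.sin y)⁻¹ = (Real.sin (x-y))⁻¹ *
      (Real.cos y * (Real.sin y)⁻¹ - Real.cos x * (Real.sin x)⁻¹) := by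
  have : Real.cos y * (Real.sin y)⁻¹ - Real.cos x * (Real.sin x)⁻¹ =
      Real.sin (x - y) * ((Real.sin x)⁻¹ * (Real.sin y)⁻¹) := by
    rw [Real.sin_sub]; field_simp
  rw [this, inv_mul_cancel_left₀ hxy]

lemma aux_G {S : ℕ} (α : Fin S → ℝ) (a c : Fin S → Fin S → ℝ)
    (ha : ∀ r s, a r s = (Real.sin (Real.pi * (α r - α s)))⁻¹)
    (hc : ∀ r s, c r s = Real.cos (Real.pi * (α r - α s)) * (Real.sin (Real.pi * (α r - α s)))⁻¹)
    (hne : ∀ r s, r ≠ s → Real.sin (Real.pi * (α r - α s)) ≠ 0) (r t : Fin S) :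
    ∑ s, a r s * a t s = a r t * ((∑ s, c t s) - ∑ s, c r s) + 2 * (a r t * c r t)
      + if r = t then ∑ s, a r s ^ 2 else 0 := by
  have a0 : ∀ r, a r r = 0 := fun r => by simp [ha]
  have c0 : ∀ r, c r r = 0 := fun r => by simp [hc]
  have cneg : ∀ r s, c s r = - c r s := fun r s => by
    rw [hc, hc, show Real.pi * (α s - α r) = -(Real.pi * (α r - α s)) by ring]; simp
  by_cases h : r = t
  · subst h; simp [a0, sq]
  · rw [if_neg h, add_zero]
    have : ∀ s, a r s * a t s = a r t * (c t s - c r s) + (if s = r then a r t * c r t else 0)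
        + (if s = t then a r t * c r t else 0) := by
      intro s
      by_cases h1 : s = r
      · subst h1; simp [h, a0, c0, cneg s t]
      by_cases h2 : s = t
      · subst h2; simp [h1, a0, c0]
      simp only [h1, h2, if_false, add_zero]
      rw [ha, ha, ha, hc, hc]
      have e : Real.pi * (α r - α t) = Real.pi * (α r - α s) - Real.pi * (α t - α s) := by ring
      rw [e]
      apply aux_id
      · exact hne _ _ (Ne.symm h1)
      · exact hne _ _ (Ne.symm h2)
      · rw [← e]; exact hne _ _ h
    simp_rw [this]
    rw [Finset.sum_add_distrib, Finset.sum_add_distrib, ← Finset.mul_sum, Finset.sum_sub_distrib]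
    simp
    ring

open ComplexConjugate in
lemma aux_eig {S : ℕ} (a c : Fin S → Fin S → ℝ) (F D : Fin S → ℝ) (M : ℝ)
    (hanti : ∀ r s, a s r = - a r s)
    (hD : ∀ r, D r = ∑ s, a r s ^ 2)
    (hcanti : ∀ r s, c s r = - c r s)
    (hG : ∀ r t, ∑ s, a r s * a t s = a r t * (F t - F r) + 2 * (a r t * c r t)
      + if r = t then D r else 0)
    (hM : ∀ r, ∑ s, (a r s ^ 2 + 2 * |a r s * c r s|) ≤ M)
    (u : Fin S → ℂ) (μ : ℝ) (hu : ∀ s, ∑ r, (a r s : ℂ) * u r = Complex.I * μ * u s) :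
    μ ^ 2 * ∑ s, ‖u s‖^2 ≤ M * ∑ s, ‖u s‖^2 := by
  have hu' : ∀ s, ∑ r, (a r s : ℂ) * conj (u r) = -Complex.I * μ * conj (u s) := by
    intro s
    have := congrArg conj (hu s)
    simpa [map_sum] using this
  have e1 : ((μ^2 * ∑ s, ‖u s‖^2 : ℝ) : ℂ) =
      ∑ r, ∑ t, u r * conj (u t) * ((∑ s, a r s * a t s : ℝ) : ℂ) := by
    calc ((μ^2 * ∑ s, ‖u s‖^2 : ℝ) : ℂ)
        = ∑ s, (∑ r, (a r s : ℂ) * u r) * (∑ t, (a t s : ℂ) * conj (u t)) := by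
          push_cast
          rw [Finset.mul_sum]
          refine Finset.sum_congr rfl fun s _ => ?_
          rw [hu, hu', ← Complex.mul_conj']
          linear_combination ((μ:ℂ)^2 * u s * conj (u s)) * Complex.I_sq
      _ = ∑ s, ∑ r, ∑ t, u r * conj (u t) * ((a r s * a t s : ℝ) : ℂ) := by
          refine Finset.sum_congr rfl fun s _ => ?_
          rw [Finset.sum_mul_sum]
          refine Finset.sum_congr rfl fun r _ => Finset.sum_congr rfl fun t _ => ?_
          push_cast; ring
      _ = _ := by
          rw [Finset.sum_comm]
          refine Finset.sum_congr rfl fun r _ => ?_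
          rw [Finset.sum_comm]
          refine Finset.sum_congr rfl fun t _ => ?_
          rw [← Finset.mul_sum]; push_cast; rfl
  have e2 : ∑ r, ∑ t, u r * conj (u t) * ((a r t * F t : ℝ) : ℂ) =
      ∑ t, Complex.I * μ * F t * (u t * conj (u t)) := by
    rw [Finset.sum_comm]
    refine Finset.sum_congr rfl fun t _ => ?_
    have : ∀ r, u r * conj (u t) * ((a r t * F t : ℝ) : ℂ) = (conj (u t) * F t) * ((a r t : ℂ) * u r) := by
      intro r; push_cast; ring
    simp_rw [this]
    rw [← Finset.mul_sum, hu]; ring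
  have e3 : ∑ r, ∑ t, u r * conj (u t) * ((a r t * F r : ℝ) : ℂ) =
      ∑ t, Complex.I * μ * F t * (u t * conj (u t)) := by
    refine Finset.sum_congr rfl fun r _ => ?_
    have : ∀ t, u r * conj (u t) * ((a r t * F r : ℝ) : ℂ) = (-(u r) * F r) * ((a t r : ℂ) * conj (u t)) := by
      intro t; rw [hanti r t]; push_cast; ring
    simp_rw [this]
    rw [← Finset.mul_sum, hu']; ring
  have e4 : ((μ^2 * ∑ s, ‖u s‖^2 : ℝ) : ℂ) =
      ∑ r, ∑ t, u r * conj (u t) * ((2 * (a r t * c r t) : ℝ) : ℂ) + ((∑ r, ‖u r‖^2 * D r : ℝ) : ℂ) := by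
    rw [e1]
    have : ∀ r t, u r * conj (u t) * ((∑ s, a r s * a t s : ℝ) : ℂ) =
        u r * conj (u t) * ((a r t * F t : ℝ) : ℂ) - u r * conj (u t) * ((a r t * F r : ℝ) : ℂ)
        + u r * conj (u t) * ((2 * (a r t * c r t) : ℝ) : ℂ)
        + if r = t then ((‖u r‖^2 * D r : ℝ) : ℂ) else 0 := by
      intro r t
      rw [hG]
      by_cases h : r = t
      · subst h
        simp only [if_true]
        push_cast
        rw [← Complex.mul_conj']
        ring
      · simp only [h, if_false]
        push_cast
        ring
    simp_rw [this, Finset.sum_add_distrib, Finset.sum_sub_distrib]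
    rw [e2, e3]
    simp
  have e5 : μ^2 * ∑ s, ‖u s‖^2 =
      ∑ r, ∑ t, (u r * conj (u t) * ((2 * (a r t * c r t) : ℝ) : ℂ)).re + ∑ r, ‖u r‖^2 * D r := by
    have := congrArg Complex.re e4
    rwa [Complex.ofReal_re, Complex.add_re, Complex.ofReal_re, Complex.re_sum,
      Finset.sum_congr rfl (fun r _ => Complex.re_sum _ _)] at this
  have e6 : ∑ r, ∑ t, (u r * conj (u t) * ((2 * (a r t * c r t) : ℝ) : ℂ)).re ≤
      ∑ r, ∑ t, (‖u r‖^2 * |a r t * c r t| + ‖u t‖^2 * |a t r * c t r|) := by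
    refine Finset.sum_le_sum fun r _ => Finset.sum_le_sum fun t _ => ?_
    refine (Complex.re_le_norm _).trans ?_
    rw [norm_mul, norm_mul, RCLike.norm_conj, Complex.norm_real, Real.norm_eq_abs, abs_mul,
      hanti r t, hcanti r t, neg_mul_neg, abs_two]
    nlinarith [mul_nonneg (sq_nonneg (‖u r‖ - ‖u t‖)) (abs_nonneg (a r t * c r t))]
  have e7 : ∑ r, ∑ t, (‖u r‖^2 * |a r t * c r t| + ‖u t‖^2 * |a t r * c t r|) =
      ∑ r, ‖u r‖^2 * ∑ t, 2 * |a r t * c r t| := by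
    simp_rw [Finset.sum_add_distrib]
    rw [Finset.sum_comm (f := fun r t => ‖u t‖^2 * |a t r * c t r|), ← Finset.sum_add_distrib]
    refine Finset.sum_congr rfl fun r _ => ?_
    rw [← Finset.sum_add_distrib, Finset.mul_sum]
    refine Finset.sum_congr rfl fun t _ => ?_
    ring
  rw [e5]
  calc _ ≤ ∑ r, ‖u r‖^2 * ∑ t, 2 * |a r t * c r t| + ∑ r, ‖u r‖^2 * D r := by
        rw [← e7]; gcongr
    _ = ∑ r, ‖u r‖^2 * ∑ s, (a r s ^ 2 + 2 * |a r s * c r s|) := by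
        rw [← Finset.sum_add_distrib]
        refine Finset.sum_congr rfl fun r _ => ?_
        rw [Finset.sum_add_distrib, hD]; ring
    _ ≤ ∑ r, ‖u r‖^2 * M := by
        refine Finset.sum_le_sum fun r _ => ?_
        exact mul_le_mul_of_nonneg_left (hM r) (by positivity)
    _ = _ := by rw [← Finset.sum_mul]; ring

lemma aux_rowsum {S : ℕ} (α : Fin S → ℝ) (δ : ℝ) (hδ : 0 < δ)
    (hsep : ∀ i j : Fin S, i ≠ j → ∀ k : ℤ, δ ≤ |α i - α j + (k : ℝ)|) (r : Fin S) :
    ∑ s, (((Real.sin (Real.pi * (α r - α s)))⁻¹)^2 + 2 * |(Real.sin (Real.pi * (α r - α s)))⁻¹ *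
      (Real.cos (Real.pi * (α r - α s)) * (Real.sin (Real.pi * (α r - α s)))⁻¹)|) ≤ 1 / δ^2 := by
  set t : Fin S → ℝ := fun s => (α r - α s) - round (α r - α s) with ht
  have ht1 : ∀ s, s ≠ r → δ ≤ |t s| := by
    intro s hs
    have := hsep r s (Ne.symm hs) (- round (α r - α s))
    push_cast at this
    simpa [ht, sub_eq_add_neg] using this
  rw [← Finset.add_sum_erase _ _ (Finset.mem_univ r)]
  simp only [sub_self, mul_zero, Real.sin_zero, _root_.inv_zero, abs_zero]
  calc _ ≤ ∑ s ∈ Finset.univ.erase r, 3 / Real.pi^2 * (1 / (t s)^2) := by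
        rw [zero_pow two_ne_zero, zero_add, zero_add]
        refine Finset.sum_le_sum fun s hs => ?_
        refine aux_trig (α r - α s) (t s) (round (α r - α s)) (by simp [ht]) (abs_sub_round _) ?_
        have := ht1 s (Finset.ne_of_mem_erase hs)
        intro h0
        rw [h0, abs_zero] at this
        linarith
    _ = 3 / Real.pi^2 * ∑ s ∈ Finset.univ.erase r, (1 / (t s)^2) := by rw [Finset.mul_sum]
    _ ≤ 3 / Real.pi^2 * (Real.pi^2/3 / δ^2) := by
        gcongr
        refine aux_sum2 _ t δ hδ (fun s hs => ht1 s (Finset.ne_of_mem_erase hs)) ?_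
        intro i _ j _ hij
        have := hsep j i (Ne.symm hij) (round (α r - α j) - round (α r - α i))
        push_cast at this
        convert this using 2
        simp only [ht]; ring
    _ = 1 / δ^2 := by
        have := Real.pi_pos
        field_simp

lemma aux_sin_ne (θ : ℝ) (h : ∀ k : ℤ, θ + k ≠ 0) : Real.sin (Real.pi * θ) ≠ 0 := by
  intro h0
  obtain ⟨n, hn⟩ := Real.sin_eq_zero_iff.1 h0
  apply h (-n)
  have : θ = n := by
    apply mul_left_cancel₀ Real.pi_ne_zero
    rw [← hn]; ring
  rw [this]; simp

open ComplexOrder in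
lemma aux_psd {S : ℕ} (H B : Matrix (Fin S) (Fin S) ℂ) (hB : B.IsHermitian) (C e : ℝ) (hC : 0 ≤ C)
    (he : e^2 = 1)
    (hH : H = (C : ℂ) • (1 : Matrix (Fin S) (Fin S) ℂ) + (e : ℂ) • B)
    (hev : ∀ (u : Fin S → ℂ) (μ : ℝ), B *ᵥ u = (μ : ℂ) • u →
      μ ^ 2 * ∑ s, ‖u s‖^2 ≤ C^2 * ∑ s, ‖u s‖^2) : H.PosSemidef := by
  have hHh : H.IsHermitian := by
    rw [hH, Matrix.IsHermitian, Matrix.conjTranspose_add, Matrix.conjTranspose_smul,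
      Matrix.conjTranspose_smul, hB.eq]
    simp
  rw [hHh.posSemidef_iff_eigenvalues_nonneg]
  intro j
  have h1 := hHh.mulVec_eigenvectorBasis j
  set v := hHh.eigenvectorBasis j with hv
  set l := hHh.eigenvalues j with hl
  have hn : ‖v‖ = 1 := hHh.eigenvectorBasis.orthonormal.1 j
  have hn2 : ∑ s, ‖v s‖^2 = 1 := by
    rw [← EuclideanSpace.norm_sq_eq, hn]; norm_num
  have h2 : B *ᵥ v = ((e * (l - C) : ℝ) : ℂ) • (v : Fin S → ℂ) := by
    have h3 : (e:ℂ) • (B *ᵥ v) = ((l - C : ℝ) : ℂ) • (v : Fin S → ℂ) := by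
      have h4 : (C:ℂ) • (v : Fin S → ℂ) + (e:ℂ) • (B *ᵥ v) = (l : ℂ) • (v : Fin S → ℂ) := by
        rw [← Matrix.smul_mulVec]
        have : (C:ℂ) • (v : Fin S → ℂ) = ((C : ℂ) • (1 : Matrix (Fin S) (Fin S) ℂ)) *ᵥ v := by
          rw [Matrix.smul_mulVec, Matrix.one_mulVec]
        rw [this, ← Matrix.add_mulVec, ← hH, h1]
        ext i; simp
      push_cast
      rw [sub_smul, ← h4]; simp
    have h5 := congrArg (fun w => (e:ℂ) • w) h3
    simp only [smul_smul] at h5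
    have h6 : (e:ℂ) * e = 1 := by rw [← sq]; exact_mod_cast he
    rw [h6, one_smul] at h5
    rw [h5]; push_cast; rfl
  have h7 := hev _ _ h2
  rw [hn2, mul_pow, he] at h7
  have h8 := (abs_le_of_sq_le_sq' (a := l - C) (b := C) (by linarith) hC).1
  simp only [Pi.zero_apply]
  linarith

open ComplexOrder ComplexConjugate in
lemma aux_form {S : ℕ} (B : Matrix (Fin S) (Fin S) ℂ) (hB : B.IsHermitian) (C e : ℝ) (hC : 0 ≤ C)
    (he : e^2 = 1)
    (hev : ∀ (u : Fin S → ℂ) (μ : ℝ), B *ᵥ u = (μ : ℂ) • u →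
      μ ^ 2 * ∑ s, ‖u s‖^2 ≤ C^2 * ∑ s, ‖u s‖^2) (z : Fin S → ℂ) :
    0 ≤ C * ∑ s, ‖z s‖^2 + e * (∑ r, ∑ s, z r * conj (z s) * B s r).re := by
  have h := (aux_psd _ B hB C e hC he rfl hev).dotProduct_mulVec_nonneg z
  have h2 := (Complex.le_def.1 h).1
  have e1 : star z ⬝ᵥ (((C : ℂ) • (1 : Matrix (Fin S) (Fin S) ℂ) + (e : ℂ) • B) *ᵥ z) =
      ((C * ∑ s, ‖z s‖^2 : ℝ) : ℂ) + (e : ℂ) * ∑ r, ∑ s, z r * conj (z s) * B s r := by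
    rw [Matrix.add_mulVec, Matrix.smul_mulVec, Matrix.smul_mulVec, Matrix.one_mulVec,
      dotProduct_add, dotProduct_smul, dotProduct_smul, smul_eq_mul, smul_eq_mul]
    congr 1
    · push_cast
      congr 1
      refine Finset.sum_congr rfl fun s _ => ?_
      rw [← Complex.mul_conj', mul_comm]; rfl
    · congr 1
      rw [Finset.sum_comm]
      refine Finset.sum_congr rfl fun s _ => ?_
      rw [Matrix.mulVec, dotProduct, Finset.mul_sum]
      refine Finset.sum_congr rfl fun r _ => ?_
      simp only [Pi.star_apply, RCLike.star_def]
      ring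
  rw [e1, Complex.add_re, Complex.ofReal_re, Complex.re_ofReal_mul] at h2
  simpa using h2

open ComplexConjugate in
/-- Montgomery–Vaughan's Hilbert-type inequality -/
lemma aux_MV {S : ℕ} (α : Fin S → ℝ) (δ : ℝ) (hδ : 0 < δ) (e : ℝ) (he : e^2 = 1)
    (hsep : ∀ i j : Fin S, i ≠ j → ∀ k : ℤ, δ ≤ |α i - α j + (k : ℝ)|) (z : Fin S → ℂ) :
    0 ≤ 1 / δ * ∑ s, ‖z s‖^2 + e * (∑ r, ∑ s, z r * conj (z s) *
      (-Complex.I * (((Real.sin (Real.pi * (α r - α s)))⁻¹ : ℝ) : ℂ))).re := by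
  set a : Fin S → Fin S → ℝ := fun r s => (Real.sin (Real.pi * (α r - α s)))⁻¹ with ha
  set c : Fin S → Fin S → ℝ := fun r s =>
    Real.cos (Real.pi * (α r - α s)) * (Real.sin (Real.pi * (α r - α s)))⁻¹ with hc
  have hanti : ∀ r s, a s r = - a r s := fun r s => by
    simp only [ha]
    rw [show Real.pi * (α s - α r) = -(Real.pi * (α r - α s)) by ring]; simp
  have hcanti : ∀ r s, c s r = - c r s := fun r s => by
    simp only [hc]
    rw [show Real.pi * (α s - α r) = -(Real.pi * (α r - α s)) by ring]; simp
  have hne : ∀ r s, r ≠ s → Real.sin (Real.pi * (α r - α s)) ≠ 0 := by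
    intro r s hrs
    apply aux_sin_ne
    intro k h0
    have := hsep r s hrs k
    rw [h0, abs_zero] at this
    linarith
  refine aux_form (Matrix.of fun s r => -Complex.I * (a r s : ℂ)) ?_ (1/δ) e (by positivity) he ?_ z
  · ext i j
    simp [hanti i j]
  · intro u μ hu
    have := aux_eig a c (fun r => ∑ s, c r s) (fun r => ∑ s, a r s ^ 2) (1/δ^2) hanti
      (fun r => rfl) hcanti (aux_G α a c (fun _ _ => rfl) (fun _ _ => rfl) hne)
      (aux_rowsum α δ hδ hsep) u μ ?_
    · rwa [_root_.one_div_pow]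
    · intro s
      have h := congrFun hu s
      simp only [Matrix.mulVec, dotProduct, Matrix.of_apply, Pi.smul_apply, smul_eq_mul] at h
      have h2 : -Complex.I * ∑ r, (a r s : ℂ) * u r = μ * u s := by
        rw [← h, Finset.mul_sum]
        refine Finset.sum_congr rfl fun r _ => by ring
      linear_combination Complex.I * h2 + (∑ r, (a r s : ℂ) * u r) * Complex.I_sq

/-- exponential -/
noncomputable def aux_e (t : ℝ) : ℂ := Complex.exp (Complex.I * (2 * Real.pi * t))

lemma aux_e_add (s t : ℝ) : aux_e (s + t) = aux_e s * aux_e t := by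
  rw [aux_e, aux_e, aux_e, ← Complex.exp_add]; congr 1; push_cast; ring

open ComplexConjugate in
lemma aux_e_conj (t : ℝ) : conj (aux_e t) = aux_e (-t) := by
  rw [aux_e, aux_e, ← Complex.exp_conj]; congr 1; simp [map_ofNat]

lemma aux_e_norm (t : ℝ) : ‖aux_e t‖ = 1 := by
  rw [aux_e, Complex.norm_exp]; simp

lemma aux_e_sin (t : ℝ) : aux_e (t/2) - aux_e (-(t/2)) = 2 * Complex.I * Real.sin (Real.pi * t) := by
  have h1 : aux_e (t/2) = Complex.exp ((Real.pi * t : ℝ) * Complex.I) := by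
    rw [aux_e]; congr 1; push_cast; ring
  have h2 : aux_e (-(t/2)) = Complex.exp (-(Real.pi * t : ℝ) * Complex.I) := by
    rw [aux_e]; congr 1; push_cast; ring
  rw [h1, h2, Complex.ofReal_sin, Complex.sin]
  linear_combination (-(Complex.exp (-(Real.pi * t : ℝ) * Complex.I)) + Complex.exp ((Real.pi * t : ℝ) * Complex.I)) * Complex.I_sq

lemma aux_geom (K : ℕ) (t : ℝ) : (∑ m ∈ Finset.range K, aux_e (m * t)) *
    (2 * Complex.I * Real.sin (Real.pi * t)) = aux_e ((K - 1/2) * t) - aux_e (-(t/2)) := by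
  rw [← aux_e_sin]
  induction K with
  | zero => 
    simp only [Finset.range_zero, Finset.sum_empty, zero_mul]
    rw [eq_comm, sub_eq_zero]; congr 1; push_cast; ring
  | succ n ih =>
    rw [Finset.sum_range_succ, add_mul, ih, mul_sub, ← aux_e_add, ← aux_e_add]
    rw [show (n:ℝ) * t + -(t/2) = (n - 1/2) * t by ring,
      show (n:ℝ) * t + t/2 = (((n+1 : ℕ):ℝ) - 1/2) * t by push_cast; ring]
    ring

open ComplexConjugate in
lemma aux_lower (K S : ℕ) (α : Fin S → ℝ) (δ : ℝ) (hδ : 0 < δ)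
    (hsep : ∀ i j : Fin S, i ≠ j → ∀ k : ℤ, δ ≤ |α i - α j + (k : ℝ)|) (x : Fin S → ℂ) :
    (K - 1 / δ) * ∑ s, ‖x s‖^2 ≤ ∑ m : Fin K, ‖∑ n, aux_e ((m : ℕ) * α n) * x n‖^2 := by
  set z : Fin S → ℂ := fun r => x r * aux_e ((K - 1/2) * α r) with hz
  set w : Fin S → ℂ := fun r => x r * aux_e (-(α r / 2)) with hw
  have hz1 := aux_MV α δ hδ 1 (by norm_num) hsep z
  have hw1 := aux_MV α δ hδ (-1) (by norm_num) hsep w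
  have hzn : ∑ s, ‖z s‖^2 = ∑ s, ‖x s‖^2 := by simp [hz, aux_e_norm]
  have hwn : ∑ s, ‖w s‖^2 = ∑ s, ‖x s‖^2 := by simp [hw, aux_e_norm]
  rw [hzn] at hz1
  rw [hwn] at hw1
  set Q : (Fin S → ℂ) → ℂ := fun z => ∑ r, ∑ s, z r * conj (z s) *
      (-Complex.I * (((Real.sin (Real.pi * (α r - α s)))⁻¹ : ℝ) : ℂ)) with hQ
  have hne : ∀ r s, r ≠ s → Real.sin (Real.pi * (α r - α s)) ≠ 0 := by
    intro r s hrs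
    apply aux_sin_ne
    intro k h0
    have := hsep r s hrs k
    rw [h0, abs_zero] at this
    linarith
  have key : ((∑ m : Fin K, ‖∑ n, aux_e ((m : ℕ) * α n) * x n‖^2 : ℝ) : ℂ) =
      ((K * ∑ s, ‖x s‖^2 : ℝ) : ℂ) + ((1/2 : ℝ) : ℂ) * (Q z - Q w) := by
    have h1 : ((∑ m : Fin K, ‖∑ n, aux_e ((m : ℕ) * α n) * x n‖^2 : ℝ) : ℂ) =
        ∑ r, ∑ s, x r * conj (x s) * ∑ m ∈ Finset.range K, aux_e (m * (α r - α s)) := by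
      have h2 : ∀ m : Fin K, ((‖∑ n, aux_e ((m : ℕ) * α n) * x n‖^2 : ℝ) : ℂ) =
          ∑ r, ∑ s, x r * conj (x s) * aux_e ((m:ℕ) * (α r - α s)) := by
        intro m
        push_cast
        rw [← Complex.mul_conj', map_sum, Finset.sum_mul_sum]
        refine Finset.sum_congr rfl fun r _ => Finset.sum_congr rfl fun s _ => ?_
        rw [map_mul, aux_e_conj, mul_sub, sub_eq_add_neg, aux_e_add]
        ring
      rw [Complex.ofReal_sum, Finset.sum_congr rfl (fun m _ => h2 m), Finset.sum_comm]
      refine Finset.sum_congr rfl fun r _ => ?_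
      rw [Finset.sum_comm]
      refine Finset.sum_congr rfl fun s _ => ?_
      rw [← Finset.mul_sum, Finset.sum_range]
    have h3 : ((K * ∑ s, ‖x s‖^2 : ℝ) : ℂ) =
        ∑ r, ∑ s, if r = s then (K : ℂ) * (x r * conj (x r)) else 0 := by
      simp [Finset.mul_sum, Complex.mul_conj']
    rw [h1, h3, hQ, ← Finset.sum_sub_distrib, Finset.mul_sum, ← Finset.sum_add_distrib]
    refine Finset.sum_congr rfl fun r _ => ?_
    rw [← Finset.sum_sub_distrib, Finset.mul_sum, ← Finset.sum_add_distrib]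
    refine Finset.sum_congr rfl fun s _ => ?_
    by_cases hrs : r = s
    · subst hrs
      simp [aux_e]
      ring
    · rw [if_neg hrs, zero_add]
      have hg := aux_geom K (α r - α s)
      have hs : (Real.sin (Real.pi * (α r - α s)) : ℂ) ≠ 0 := by exact_mod_cast hne r s hrs
      have hg2 : ∑ m ∈ Finset.range K, aux_e (m * (α r - α s)) =
          (aux_e ((K - 1/2) * (α r - α s)) - aux_e (-((α r - α s)/2))) *
          (-Complex.I / 2 * (Real.sin (Real.pi * (α r - α s)) : ℂ)⁻¹) := by
        rw [← hg]
        generalize (∑ m ∈ Finset.range K, aux_e (m * (α r - α s))) = X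
        generalize (Real.sin (Real.pi * (α r - α s)) : ℂ) = Y at hs
        linear_combination (-X) * mul_inv_cancel₀ hs + (X * (Y * Y⁻¹)) * Complex.I_sq
      rw [hg2]
      simp only [hz, hw, map_mul, aux_e_conj]
      rw [show ((K:ℝ) - 1/2) * (α r - α s) = (K - 1/2) * α r + -((K - 1/2) * α s) by ring,
        show -((α r - α s)/2) = -(α r/2) + -(-(α s / 2)) by ring, aux_e_add, aux_e_add]
      push_cast
      ring
  have key2 := congrArg Complex.re key
  rw [Complex.ofReal_re, Complex.add_re, Complex.ofReal_re, Complex.re_ofReal_mul,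
    Complex.sub_re] at key2
  rw [key2]
  simp only [hQ]
  linarith

/-- **Smallest singular value of a well-separated Vandermonde matrix** (Lemma 7): if the
wrap-around separation of the distinct nodes `α_i ∈ [0,1)` is at least `γ/K` for some
`γ > 1`, then `σ_S(V(α))² ≥ K/C′` with `C′ = γ/(γ−1)`. -/
theorem vandermonde_well_separated_min_singular_value (K S : ℕ) (hS : 1 ≤ S) (hSK : S ≤ K)
    (α : Fin S → ℝ) (hα01 : ∀ i, α i ∈ Set.Ico (0 : ℝ) 1) (hinj : Function.Injective α)
    (γ : ℝ) (hγ : 1 < γ)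
    (hsep : ∀ i j : Fin S, i ≠ j → ∀ k : ℤ, γ / K ≤ |α i - α j + (k : ℝ)|) :
    (K : ℝ) / (γ / (γ - 1)) ≤ sval (vandermonde K S α) S ^ 2 := by
  have hK : (0:ℝ) < K := by exact_mod_cast (by omega : 0 < K)
  have hγ0 : 0 < γ := by linarith
  have hKC : (K : ℝ) / (γ / (γ - 1)) = K - 1 / (γ / K) := by
    have : γ - 1 ≠ 0 := by linarith
    field_simp
  have hpos : 0 ≤ (K : ℝ) / (γ / (γ - 1)) := by
    have : 0 < γ - 1 := by linarith
    positivity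
  have hle : Real.sqrt ((K : ℝ) / (γ / (γ - 1))) ≤ sval (vandermonde K S α) S := by
    apply le_csSup
    · set L := LinearMap.toContinuousLinearMap (Matrix.toEuclideanLin (vandermonde K S α)) with hL
      refine ⟨‖L‖, ?_⟩
      rintro r ⟨hr, V, hV, h⟩
      have : 0 < Module.finrank ℂ V := by omega
      have := Module.nontrivial_of_finrank_pos this
      obtain ⟨⟨v, hv⟩, hv0⟩ := exists_ne (0 : V)
      have hv1 : 0 < ‖v‖ := norm_pos_iff.2 (fun h0 => hv0 (by simp [h0]))
      have h1 := h v hv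
      have h2 : ‖Matrix.toEuclideanLin (vandermonde K S α) v‖ ≤ ‖L‖ * ‖v‖ := L.le_opNorm v
      exact le_of_mul_le_mul_right (h1.trans h2) hv1
    · refine ⟨Real.sqrt_nonneg _, ⊤, by simp, ?_⟩
      intro x _
      have h := aux_lower K S α (γ / K) (by positivity) hsep x
      rw [← hKC, ← EuclideanSpace.norm_sq_eq] at h
      have h2 : ‖Matrix.toEuclideanLin (vandermonde K S α) x‖^2 =
          ∑ m : Fin K, ‖∑ n, aux_e ((m : ℕ) * α n) * x n‖^2 := by
        rw [EuclideanSpace.norm_sq_eq]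
        refine Finset.sum_congr rfl fun m _ => ?_
        congr 2
        simp only [Matrix.toLpLin_apply, Matrix.mulVec, dotProduct, _root_.vandermonde, Matrix.of_apply,
          aux_e]
        refine Finset.sum_congr rfl fun n _ => ?_
        congr 2
        push_cast; ring
      rw [← h2] at h
      refine (pow_le_pow_iff_left₀ (by positivity) (norm_nonneg _) two_ne_zero).1 ?_
      rw [mul_pow, Real.sq_sqrt hpos]
      exact h
  calc (K : ℝ) / (γ / (γ - 1)) = Real.sqrt ((K : ℝ) / (γ / (γ - 1)))^2 := (Real.sq_sqrt hpos).symm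
    _ ≤ _ := pow_le_pow_left₀ (Real.sqrt_nonneg _) hle 2
end

section
/- Proposition 2 (well-separated singular value bound for the nested array): Let P ≥ 3 and let 𝕊 = 𝕊^{(N₁,N₂)} be the nested array with N₁ = ⌈P/2⌉ and N₂ = ⌊P/2⌋, whose coarray ULA is U_𝕊 = {0, 1, …, M_ca} with M_ca = N₂(N₁+1) − 1. Let ω₁, …, ω_S ∈ [0,1) be distinct with S ≤ P²/5, and suppose that for some γ > 1 the minimum separation satisfies Δ_min(ω) ≥ 5γ/P². Then σ_S(A_U(ω))² ≥ P²/C_n′, where C_n′ = 5γ/(γ−1) and A_U(ω) ∈ ℂ^{(M_ca+1)×S} is the coarray manifold matrix. -/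
open Matrix

lemma trig_ineq {x : ℝ} (hx0 : 0 ≤ x) (hx : x ≤ Real.pi / 2) :
    x ^ 2 * (1 + 2 * Real.cos x) ≤ 3 * Real.sin x ^ 2 := by
  have h2 : x ≤ 2 := by linarith [Real.pi_le_four]
  have hx2 : x ^ 2 ≤ 4 := by nlinarith
  have h1 := Real.sin_ge_sub_cube hx0
  have h3 := Real.sin_ge_sub_cube (x := x / 2) (by linarith)
  have hc : Real.cos x = 1 - 2 * Real.sin (x / 2) ^ 2 := by
    have := Real.cos_sq_add_sin_sq (x / 2)
    have h := Real.cos_two_mul (x / 2)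
    rw [show 2 * (x / 2) = x by ring] at h
    rw [h]; linarith
  have e1 : 0 ≤ x - x ^ 3 / 6 := by nlinarith
  have e2 : 0 ≤ x / 2 - (x / 2) ^ 3 / 6 := by nlinarith
  have f1 : (x - x ^ 3 / 6) ^ 2 ≤ Real.sin x ^ 2 := pow_le_pow_left₀ e1 h1 2
  have f2 : (x / 2 - (x / 2) ^ 3 / 6) ^ 2 ≤ Real.sin (x / 2) ^ 2 := pow_le_pow_left₀ e2 h3 2
  have f3 : Real.cos x ≤ 1 - x ^ 2 / 2 + x ^ 4 / 24 := by
    rw [hc]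
    nlinarith [pow_nonneg hx0 6]
  have f4 : x ^ 2 * (1 + 2 * Real.cos x) ≤ x ^ 2 * (1 + 2 * (1 - x ^ 2 / 2 + x ^ 4 / 24)) := by
    gcongr
  nlinarith

/-- one-sided sum over separated positive points -/
lemma sum_pos_sep {ι : Type*} (T : Finset ι) (θ : ι → ℝ) (δ : ℝ) (hδ : 0 < δ)
    (h1 : ∀ t ∈ T, δ ≤ θ t)
    (h2 : ∀ t ∈ T, ∀ t' ∈ T, t ≠ t' → δ ≤ |θ t - θ t'|) :
    ∑ t ∈ T, 1 / θ t ^ 2 ≤ Real.pi ^ 2 / (6 * δ ^ 2) := by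
  classical
  set m : ι → ℕ := fun t => ⌊θ t / δ⌋₊ with hm
  have hle : ∀ t ∈ T, (m t : ℝ) * δ ≤ θ t := fun t ht => by
    have : (m t : ℝ) ≤ θ t / δ := Nat.floor_le (div_nonneg (hδ.le.trans (h1 t ht)) hδ.le)
    rwa [le_div_iff₀ hδ] at this
  have hlt : ∀ t ∈ T, θ t < ((m t : ℝ) + 1) * δ := fun t ht => by
    have : θ t / δ < (m t : ℝ) + 1 := Nat.lt_floor_add_one _
    rwa [div_lt_iff₀ hδ] at this
  have hm1 : ∀ t ∈ T, 1 ≤ m t := fun t ht => by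
    apply Nat.le_floor
    rw [le_div_iff₀ hδ]; simpa using h1 t ht
  have hinj : Set.InjOn m T := by
    intro a ha b hb hab
    by_contra hne
    have h := h2 a ha b hb hne
    have a1 := hle a ha
    have a2 := hlt a ha
    have b1 := hle b hb
    have b2 := hlt b hb
    rw [hab] at a1 a2
    have : |θ a - θ b| < δ := by rw [abs_lt]; constructor <;> nlinarith
    linarith
  have hz := hasSum_zeta_two
  calc ∑ t ∈ T, 1 / θ t ^ 2 ≤ ∑ t ∈ T, (1 / δ ^ 2) * (1 / (m t : ℝ) ^ 2) := by
        apply Finset.sum_le_sum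
        intro t ht
        have := hm1 t ht
        have hp : (0 : ℝ) < m t := by exact_mod_cast this
        rw [one_div_mul_one_div_rev, ← mul_pow]
        exact one_div_le_one_div_of_le (by positivity) (pow_le_pow_left₀ (by positivity) (hle t ht) 2)
    _ = (1 / δ ^ 2) * ∑ n ∈ T.image m, 1 / (n : ℝ) ^ 2 := by
        rw [Finset.sum_image hinj, Finset.mul_sum]
    _ ≤ (1 / δ ^ 2) * (Real.pi ^ 2 / 6) := by
        gcongr
        exact sum_le_hasSum _ (fun _ _ => by positivity) hz
    _ = _ := by field_simp

lemma sum_sep {ι : Type*} (T : Finset ι) (θ : ι → ℝ) (δ : ℝ) (hδ : 0 < δ)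
    (h1 : ∀ t ∈ T, δ ≤ |θ t|)
    (h2 : ∀ t ∈ T, ∀ t' ∈ T, t ≠ t' → δ ≤ |θ t - θ t'|) :
    ∑ t ∈ T, 1 / θ t ^ 2 ≤ Real.pi ^ 2 / (3 * δ ^ 2) := by
  classical
  rw [← Finset.sum_filter_add_sum_filter_not T (fun t => 0 ≤ θ t)]
  have a := sum_pos_sep (T.filter (fun t => 0 ≤ θ t)) θ δ hδ
    (fun t ht => by
      rw [Finset.mem_filter] at ht
      have := h1 t ht.1
      rwa [abs_of_nonneg ht.2] at this)
    (fun t ht t' ht' => h2 t (Finset.mem_filter.1 ht).1 t' (Finset.mem_filter.1 ht').1)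
  have b := sum_pos_sep (T.filter (fun t => ¬ 0 ≤ θ t)) (fun t => - θ t) δ hδ
    (fun t ht => by
      rw [Finset.mem_filter] at ht
      have := h1 t ht.1
      rwa [abs_of_neg (not_le.1 ht.2)] at this)
    (fun t ht t' ht' hne => by
      have := h2 t (Finset.mem_filter.1 ht).1 t' (Finset.mem_filter.1 ht').1 hne
      rw [← abs_neg] at this
      convert this using 2; ring)
  simp only [neg_sq] at b
  have : Real.pi ^ 2 / (3 * δ ^ 2) = Real.pi ^ 2 / (6 * δ ^ 2) + Real.pi ^ 2 / (6 * δ ^ 2) := by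
    field_simp; norm_num
  linarith

noncomputable def cs {S : ℕ} (ω : Fin S → ℝ) (r s : Fin S) : ℝ := (Real.sin (Real.pi * (ω r - ω s)))⁻¹
noncomputable def kt {S : ℕ} (ω : Fin S → ℝ) (r s : Fin S) : ℝ :=
  Real.cos (Real.pi * (ω r - ω s)) / Real.sin (Real.pi * (ω r - ω s))

lemma cs_anti {S : ℕ} (ω : Fin S → ℝ) (r s : Fin S) : cs ω r s = - cs ω s r := by
  unfold cs
  rw [show Real.pi * (ω r - ω s) = -(Real.pi * (ω s - ω r)) by ring, Real.sin_neg, inv_neg]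
lemma kt_anti {S : ℕ} (ω : Fin S → ℝ) (r s : Fin S) : kt ω r s = - kt ω s r := by
  unfold kt
  rw [show Real.pi * (ω r - ω s) = -(Real.pi * (ω s - ω r)) by ring, Real.sin_neg, Real.cos_neg,
    div_neg]
lemma cs_self {S : ℕ} (ω : Fin S → ℝ) (r : Fin S) : cs ω r r = 0 := by simp [cs]
lemma kt_self {S : ℕ} (ω : Fin S → ℝ) (r : Fin S) : kt ω r r = 0 := by simp [kt]

lemma sin_pi_ne {θ δ : ℝ} (hδ : 0 < δ) (h : ∀ k : ℤ, δ ≤ |θ + k|) :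
    Real.sin (Real.pi * θ) ≠ 0 := by
  intro h0
  rw [Real.sin_eq_zero_iff] at h0
  obtain ⟨n, hn⟩ := h0
  have : θ = n := by
    have := Real.pi_pos
    have h' : Real.pi * (θ - n) = 0 := by linarith
    rcases mul_eq_zero.1 h' with h' | h' <;> linarith
  have h2 := h (-n)
  rw [this] at h2
  simp at h2
  linarith

lemma cs_kt {S : ℕ} (ω : Fin S → ℝ) (δ : ℝ) (hδ : 0 < δ)
    (hsep : ∀ i j : Fin S, i ≠ j → ∀ k : ℤ, δ ≤ |ω i - ω j + (k : ℝ)|) (r s t : Fin S)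
    (h1 : r ≠ s) (h2 : r ≠ t) (h3 : s ≠ t) :
    cs ω r s * cs ω r t = cs ω s t * (kt ω r s - kt ω r t) := by
  have a := sin_pi_ne hδ (hsep r s h1)
  have b := sin_pi_ne hδ (hsep r t h2)
  have c := sin_pi_ne hδ (hsep s t h3)
  unfold cs kt
  have e : Real.sin (Real.pi * (ω s - ω t)) =
    Real.sin (Real.pi * (ω r - ω t)) * Real.cos (Real.pi * (ω r - ω s)) -
    Real.cos (Real.pi * (ω r - ω t)) * Real.sin (Real.pi * (ω r - ω s)) := by
    rw [← Real.sin_sub]; congr 1; ring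
  field_simp
  rw [e]; ring

lemma term_bound {θ : ℝ} (hs : Real.sin (Real.pi * θ) ≠ 0) :
    (Real.sin (Real.pi * θ))⁻¹ ^ 2 + 2 * |(Real.sin (Real.pi * θ))⁻¹ *
      (Real.cos (Real.pi * θ) / Real.sin (Real.pi * θ))| ≤
      3 / Real.pi ^ 2 * (1 / (θ - round θ) ^ 2) := by
  set y := θ - round θ with hy
  have hyl : |y| ≤ 1 / 2 := abs_sub_round θ
  have hpi := Real.pi_pos
  have e : Real.pi * θ = Real.pi * y + (round θ : ℤ) * Real.pi := by rw [hy]; ring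
  have hsin : Real.sin (Real.pi * θ) ^ 2 = Real.sin (Real.pi * |y|) ^ 2 := by
    rw [e, Real.sin_add_int_mul_pi, mul_pow, ← sq_abs ((-1 : ℝ) ^ _), abs_zpow]
    rcases abs_choice y with h | h <;> rw [h] <;> simp
  have hcos : |Real.cos (Real.pi * θ)| = Real.cos (Real.pi * |y|) := by
    have : 0 ≤ Real.cos (Real.pi * |y|) := by
      apply Real.cos_nonneg_of_mem_Icc
      constructor <;> nlinarith [abs_nonneg y]
    rw [← abs_of_nonneg this, e, Real.cos_add_int_mul_pi, abs_mul, abs_zpow]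
    rcases abs_choice y with h | h <;> rw [h] <;> simp
  have hy0 : y ≠ 0 := by
    intro h0
    rw [h0] at hsin
    simp at hsin
    exact hs hsin
  have hs2 : 0 < Real.sin (Real.pi * θ) ^ 2 := by positivity
  have key := trig_ineq (x := Real.pi * |y|) (by positivity) (by nlinarith)
  rw [← hcos, ← hsin, mul_pow, sq_abs] at key
  have l : (Real.sin (Real.pi * θ))⁻¹ ^ 2 + 2 * |(Real.sin (Real.pi * θ))⁻¹ *
      (Real.cos (Real.pi * θ) / Real.sin (Real.pi * θ))| =
      (1 + 2 * |Real.cos (Real.pi * θ)|) / Real.sin (Real.pi * θ) ^ 2 := by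
    rw [abs_mul, abs_div, abs_inv, ← sq_abs (Real.sin _), inv_pow, sq_abs, ← sq_abs (Real.sin _)]
    have := abs_pos.2 hs
    field_simp
  rw [l, div_mul_div_comm, mul_one, div_le_div_iff₀ hs2 (by positivity)]
  linarith

lemma row_bound {S : ℕ} (ω : Fin S → ℝ) (δ : ℝ) (hδ : 0 < δ)
    (hsep : ∀ i j : Fin S, i ≠ j → ∀ k : ℤ, δ ≤ |ω i - ω j + (k : ℝ)|) (s : Fin S) :
    ∑ t, (cs ω s t ^ 2 + 2 * |cs ω s t * kt ω s t|) ≤ 1 / δ ^ 2 := by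
  classical
  rw [← Finset.add_sum_erase _ _ (Finset.mem_univ s)]
  simp only [cs_self]
  have h : ∑ t ∈ Finset.univ.erase s, (cs ω s t ^ 2 + 2 * |cs ω s t * kt ω s t|) ≤
      ∑ t ∈ Finset.univ.erase s, 3 / Real.pi ^ 2 *
        (1 / (ω s - ω t - round (ω s - ω t)) ^ 2) := by
    apply Finset.sum_le_sum
    intro t ht
    have hne : s ≠ t := (Finset.ne_of_mem_erase ht).symm
    exact term_bound (sin_pi_ne hδ (hsep s t hne))
  have h2 := sum_sep (Finset.univ.erase s)
    (fun t => ω s - ω t - round (ω s - ω t)) δ hδ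
    (fun t ht => by
      have hne : s ≠ t := (Finset.ne_of_mem_erase ht).symm
      have := hsep s t hne (-round (ω s - ω t))
      push_cast at this
      simpa [sub_eq_add_neg] using this)
    (fun t ht t' ht' hne => by
      have := hsep t' t hne.symm (round (ω s - ω t') - round (ω s - ω t))
      push_cast at this
      convert this using 2; ring)
  rw [← Finset.mul_sum] at h
  have h3 : 3 / Real.pi ^ 2 * (Real.pi ^ 2 / (3 * δ ^ 2)) = 1 / δ ^ 2 := by
    have := Real.pi_pos
    field_simp
  have h4 := mul_le_mul_of_nonneg_left h2 (show 0 ≤ 3 / Real.pi ^ 2 by positivity)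
  rw [h3] at h4
  simp
  simp at h h4
  linarith

lemma gram_cs {S : ℕ} (ω : Fin S → ℝ) (δ : ℝ) (hδ : 0 < δ)
    (hsep : ∀ i j : Fin S, i ≠ j → ∀ k : ℤ, δ ≤ |ω i - ω j + (k : ℝ)|) (s t : Fin S) :
    ∑ r, cs ω r s * cs ω r t = cs ω s t * ((∑ r, kt ω r s) - ∑ r, kt ω r t) +
      (if s = t then ∑ r, cs ω s r ^ 2 else 0) + 2 * (cs ω s t * kt ω s t) := by
  classical
  by_cases hst : s = t
  · subst hst
    simp only [cs_self, if_true, zero_mul, mul_zero, add_zero, zero_add]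
    apply Finset.sum_congr rfl
    intro r _
    rw [cs_anti ω r s]; ring
  · rw [if_neg hst]
    have hpt : ∀ r, cs ω r s * cs ω r t = cs ω s t * (kt ω r s - kt ω r t) +
        ((if r = s then cs ω s t * kt ω s t else 0) +
         (if r = t then cs ω s t * kt ω s t else 0)) := by
      intro r
      by_cases h1 : r = s
      · subst h1
        simp [cs_self, kt_self, hst]
      · by_cases h2 : r = t
        · subst h2
          simp only [cs_self, kt_self, h1, if_true, if_false]
          rw [kt_anti ω r s]; ring
        · rw [cs_kt ω δ hδ hsep r s t h1 h2 hst]; simp [h1, h2]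
    rw [Finset.sum_congr rfl (fun r _ => hpt r), Finset.sum_add_distrib, Finset.sum_add_distrib,
      ← Finset.mul_sum, Finset.sum_sub_distrib]
    simp
    ring

lemma eig_bound {S : ℕ} (ω : Fin S → ℝ) (δ : ℝ) (hδ : 0 < δ)
    (hsep : ∀ i j : Fin S, i ≠ j → ∀ k : ℤ, δ ≤ |ω i - ω j + (k : ℝ)|)
    (u : Fin S → ℂ) (hu : u ≠ 0) (μ : ℝ)
    (he : ∀ r, ∑ s, (cs ω r s : ℂ) * u s = Complex.I * μ * u r) : μ ^ 2 ≤ 1 / δ ^ 2 := by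
  classical
  set c := cs ω with hc
  set V : Fin S → ℝ := fun s => ∑ r, kt ω r s with hV
  have hL : ∑ r, (∑ s, (c r s : ℂ) * u s) * starRingEnd ℂ (∑ t, (c r t : ℂ) * u t) =
      ((μ ^ 2 * ∑ r, ‖u r‖ ^ 2 : ℝ) : ℂ) := by
    push_cast
    rw [Finset.mul_sum]
    apply Finset.sum_congr rfl
    intro r _
    rw [he r, Complex.mul_conj']
    simp [mul_pow]
    norm_cast
    left; exact sq_abs μ
  have hR : ∑ r, (∑ s, (c r s : ℂ) * u s) * starRingEnd ℂ (∑ t, (c r t : ℂ) * u t) =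
      ∑ s, ∑ t, u s * starRingEnd ℂ (u t) * ((∑ r, c r s * c r t : ℝ) : ℂ) := by
    simp only [map_sum, map_mul, Complex.conj_ofReal, Finset.sum_mul_sum]
    rw [Finset.sum_comm]
    apply Finset.sum_congr rfl
    intro s _
    rw [Finset.sum_comm]
    apply Finset.sum_congr rfl
    intro t _
    push_cast
    rw [Finset.mul_sum]
    apply Finset.sum_congr rfl
    intro r _
    ring
  have hA1 : ∑ s, ∑ t, u s * starRingEnd ℂ (u t) * ((c s t * V s : ℝ) : ℂ) =
      ∑ s, (V s : ℂ) * (u s * starRingEnd ℂ (u s)) * (-(Complex.I * μ)) := by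
    apply Finset.sum_congr rfl
    intro s _
    have := congrArg (starRingEnd ℂ) (he s)
    simp only [map_sum, map_mul, Complex.conj_ofReal, Complex.conj_I] at this
    calc _ = (V s : ℂ) * u s * ∑ t, (c s t : ℂ) * starRingEnd ℂ (u t) := by
            rw [Finset.mul_sum]
            apply Finset.sum_congr rfl
            intro t _
            push_cast; ring
      _ = _ := by rw [this]; ring
  have hA2 : ∑ s, ∑ t, u s * starRingEnd ℂ (u t) * ((c s t * V t : ℝ) : ℂ) =
      ∑ s, (V s : ℂ) * (u s * starRingEnd ℂ (u s)) * (-(Complex.I * μ)) := by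
    rw [Finset.sum_comm]
    apply Finset.sum_congr rfl
    intro t _
    calc _ = -((V t : ℂ) * starRingEnd ℂ (u t)) * ∑ s, (c t s : ℂ) * u s := by
            rw [Finset.mul_sum]
            apply Finset.sum_congr rfl
            intro s _
            rw [hc, cs_anti ω s t]
            push_cast; ring
      _ = _ := by rw [he]; ring
  have hmain : ((μ ^ 2 * ∑ r, ‖u r‖ ^ 2 : ℝ) : ℂ) =
      ((∑ s, ‖u s‖ ^ 2 * ∑ r, c s r ^ 2 : ℝ) : ℂ) +
      ∑ s, ∑ t, u s * starRingEnd ℂ (u t) * ((2 * (c s t * kt ω s t) : ℝ) : ℂ) := by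
    rw [← hL, hR]
    have : ∀ s t, u s * starRingEnd ℂ (u t) * ((∑ r, c r s * c r t : ℝ) : ℂ) =
        u s * starRingEnd ℂ (u t) * ((c s t * V s : ℝ) : ℂ) -
        u s * starRingEnd ℂ (u t) * ((c s t * V t : ℝ) : ℂ) +
        (if s = t then u s * starRingEnd ℂ (u t) * ((∑ r, c s r ^ 2 : ℝ) : ℂ) else 0) +
        u s * starRingEnd ℂ (u t) * ((2 * (c s t * kt ω s t) : ℝ) : ℂ) := by
      intro s t
      rw [gram_cs ω δ hδ hsep s t]
      simp only [hc, hV]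
      split_ifs <;> push_cast <;> ring
    simp only [this, Finset.sum_add_distrib, Finset.sum_sub_distrib]
    rw [hA1, hA2, sub_self, zero_add]
    congr 1
    push_cast
    apply Finset.sum_congr rfl
    intro s _
    simp [Complex.mul_conj']
  have hre := congrArg Complex.re hmain
  rw [Complex.add_re, Complex.ofReal_re, Complex.ofReal_re] at hre
  have hb : (∑ s, ∑ t, u s * starRingEnd ℂ (u t) * ((2 * (c s t * kt ω s t) : ℝ) : ℂ)).re ≤
      ∑ s, ‖u s‖ ^ 2 * ∑ t, 2 * |c s t * kt ω s t| := by
    calc _ ≤ ‖∑ s, ∑ t, u s * starRingEnd ℂ (u t) * ((2 * (c s t * kt ω s t) : ℝ) : ℂ)‖ :=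
          Complex.re_le_norm _
      _ ≤ ∑ s, ∑ t, (‖u s‖ ^ 2 * |c s t * kt ω s t| + ‖u t‖ ^ 2 * |c s t * kt ω s t|) := by
          refine (norm_sum_le _ _).trans (Finset.sum_le_sum fun s _ => ?_)
          refine (norm_sum_le _ _).trans (Finset.sum_le_sum fun t _ => ?_)
          rw [norm_mul, norm_mul, RCLike.norm_conj, Complex.norm_real, Real.norm_eq_abs, abs_mul,
            abs_two]
          nlinarith [abs_nonneg (c s t * kt ω s t),
            mul_nonneg (abs_nonneg (c s t * kt ω s t)) (sq_nonneg (‖u s‖ - ‖u t‖))]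
      _ = ∑ s, ∑ t, ‖u s‖ ^ 2 * |c s t * kt ω s t| + ∑ s, ∑ t, ‖u s‖ ^ 2 * |c s t * kt ω s t| := by
          simp only [Finset.sum_add_distrib]
          congr 1
          rw [Finset.sum_comm]
          refine Finset.sum_congr rfl fun s _ => Finset.sum_congr rfl fun t _ => ?_
          rw [hc, cs_anti ω t s, kt_anti ω t s, neg_mul_neg]
      _ = _ := by
          rw [← Finset.sum_add_distrib]
          refine Finset.sum_congr rfl fun s _ => ?_
          rw [← Finset.mul_sum, ← Finset.mul_sum]; ring
  have hpos : 0 < ∑ r, ‖u r‖ ^ 2 := by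
    obtain ⟨i, hi⟩ := Function.ne_iff.1 hu
    apply Finset.sum_pos' (fun _ _ => by positivity)
    exact ⟨i, Finset.mem_univ _, by have := norm_pos_iff.2 hi; positivity⟩
  have hfin : μ ^ 2 * ∑ r, ‖u r‖ ^ 2 ≤ 1 / δ ^ 2 * ∑ r, ‖u r‖ ^ 2 := by
    rw [hre]
    refine (add_le_add_right hb _).trans ?_
    rw [← Finset.sum_add_distrib, Finset.mul_sum]
    apply Finset.sum_le_sum
    intro s _
    rw [← mul_add, ← Finset.sum_add_distrib, mul_comm]
    exact mul_le_mul_of_nonneg_right (row_bound ω δ hδ hsep s) (by positivity)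
  exact le_of_mul_le_mul_right hfin hpos

open ComplexOrder in
lemma hilbert_half {S : ℕ} (ω : Fin S → ℝ) (δ : ℝ) (hδ : 0 < δ)
    (hsep : ∀ i j : Fin S, i ≠ j → ∀ k : ℤ, δ ≤ |ω i - ω j + (k : ℝ)|)
    (σ : ℝ) (hσ : σ ^ 2 = 1) (x : Fin S → ℂ) :
    σ * (∑ r, ∑ s, starRingEnd ℂ (x r) * x s * (cs ω r s : ℂ)).im ≤
      1 / δ * ∑ r, ‖x r‖ ^ 2 := by
  classical
  set H : Matrix (Fin S) (Fin S) ℂ :=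
    ((1 / δ : ℝ) : ℂ) • (1 : Matrix (Fin S) (Fin S) ℂ) +
      Matrix.of (fun r s => Complex.I * σ * (cs ω r s : ℂ)) with hH
  have hmv : ∀ (x : Fin S → ℂ) r, (H *ᵥ x) r =
      ((1 / δ : ℝ) : ℂ) * x r + Complex.I * σ * ∑ s, (cs ω r s : ℂ) * x s := by
    intro x r
    rw [hH, Matrix.add_mulVec, Matrix.smul_mulVec, Matrix.one_mulVec]
    simp only [Pi.add_apply, Pi.smul_apply, smul_eq_mul, Matrix.mulVec, dotProduct, Matrix.of_apply,
      Finset.mul_sum]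
    congr 1
    exact Finset.sum_congr rfl fun s _ => by ring
  have hherm : H.IsHermitian := by
    ext r s
    simp only [hH, Matrix.conjTranspose_apply, Matrix.add_apply, Matrix.smul_apply, Matrix.of_apply,
      Matrix.one_apply, smul_eq_mul]
    rw [cs_anti ω s r]
    by_cases h : r = s
    · subst h; simp
    · simp [h, Ne.symm h]
  have hpsd : H.PosSemidef := by
    rw [hherm.posSemidef_iff_eigenvalues_nonneg]
    intro i
    have hev := hherm.mulVec_eigenvectorBasis i
    set u : Fin S → ℂ := (hherm.eigenvectorBasis i).ofLp with hu
    have hune : u ≠ 0 := by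
      intro h0
      have := hherm.eigenvectorBasis.orthonormal.ne_zero i
      apply this
      ext j
      exact congrFun h0 j
    set l := hherm.eigenvalues i with hl
    have hs2 : (σ : ℂ) * σ = 1 := by norm_cast; rw [← sq]; exact hσ
    have hb := eig_bound ω δ hδ hsep u hune (σ * (1 / δ - l)) (by
      intro r
      have := congrFun hev r
      rw [hmv] at this
      simp only [Pi.smul_apply, Complex.real_smul] at this
      push_cast
      push_cast at this
      linear_combination (-(Complex.I * σ)) * this +
        (-∑ s, (cs ω r s : ℂ) * u s) * hs2 + (σ:ℂ)^2 * (∑ s, (cs ω r s : ℂ) * u s) * Complex.I_sq)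
    rw [mul_pow, hσ, one_mul, ← _root_.one_div_pow] at hb
    have := abs_le_of_sq_le_sq hb (by positivity)
    simp only [Pi.zero_apply]
    linarith [(abs_le.1 (abs_le_of_sq_le_sq hb (by positivity))).2]
  have h0 := hpsd.dotProduct_mulVec_nonneg x
  have h1 := (Complex.le_def.1 h0).1
  have e : star x ⬝ᵥ (H *ᵥ x) = ((1 / δ * ∑ r, ‖x r‖ ^ 2 : ℝ) : ℂ) +
      Complex.I * σ * ∑ r, ∑ s, starRingEnd ℂ (x r) * x s * (cs ω r s : ℂ) := by
    simp only [dotProduct, hmv, Pi.star_apply]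
    push_cast
    rw [Finset.mul_sum, Finset.mul_sum, ← Finset.sum_add_distrib]
    refine Finset.sum_congr rfl fun r _ => ?_
    rw [← Complex.conj_mul', mul_add, Finset.mul_sum, Finset.mul_sum, Finset.mul_sum]
    congr 1
    · simp only [RCLike.star_def]; push_cast; ring
    · exact Finset.sum_congr rfl fun s _ => by simp only [RCLike.star_def]; ring
  rw [e, Complex.add_re, Complex.ofReal_re] at h1
  simp only [Complex.mul_re, Complex.mul_im, Complex.I_re, Complex.I_im, Complex.ofReal_re,
    Complex.ofReal_im, Complex.zero_re] at h1
  linarith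

noncomputable def E (a : ℝ) : ℂ := Complex.exp (2 * Real.pi * a * Complex.I)

lemma E_add (a b : ℝ) : E (a + b) = E a * E b := by
  unfold E; rw [← Complex.exp_add]; push_cast; ring_nf
lemma E_conj (a : ℝ) : starRingEnd ℂ (E a) = E (-a) := by
  unfold E; rw [← Complex.exp_conj]; simp [Complex.conj_ofNat]
lemma E_norm (a : ℝ) : ‖E a‖ = 1 := by
  unfold E
  have := Complex.norm_exp_ofReal_mul_I (2 * Real.pi * a)
  push_cast at this; exact this
lemma E_zero : E 0 = 1 := by simp [E]

lemma E_sum (N : ℕ) (θ : ℝ) :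
    (∑ n ∈ Finset.range N, E (n * θ)) * (E (θ / 2) - E (-(θ / 2))) =
      E ((N - 1 / 2) * θ) - E (-(θ / 2)) := by
  induction N with
  | zero =>
    rw [show ((0 : ℕ) - 1 / 2 : ℝ) * θ = -(θ / 2) by push_cast; ring]; simp
  | succ n ih =>
    rw [Finset.sum_range_succ, add_mul, ih, mul_sub, ← E_add, ← E_add]
    push_cast
    rw [show (n : ℝ) * θ + -(θ / 2) = (n - 1 / 2) * θ by ring,
      show (n : ℝ) * θ + θ / 2 = (n + 1 - 1 / 2) * θ by ring]
    ring

lemma E_sin (θ : ℝ) : E (θ / 2) - E (-(θ / 2)) = 2 * Complex.I * (Real.sin (Real.pi * θ) : ℂ) := by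
  unfold E
  rw [Complex.ofReal_sin, Complex.sin]
  push_cast
  rw [show 2 * (Real.pi : ℂ) * (θ / 2) * Complex.I = Real.pi * θ * Complex.I by ring,
    show 2 * (Real.pi : ℂ) * (-(θ / 2)) * Complex.I = -(Real.pi * θ) * Complex.I by ring]
  linear_combination (-(Complex.exp (-(Real.pi * θ) * Complex.I) -
    Complex.exp (Real.pi * θ * Complex.I))) * Complex.I_sq

lemma dirichlet {S : ℕ} (ω : Fin S → ℝ) (δ : ℝ) (hδ : 0 < δ)
    (hsep : ∀ i j : Fin S, i ≠ j → ∀ k : ℤ, δ ≤ |ω i - ω j + (k : ℝ)|) (N : ℕ) (r s : Fin S) :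
    ∑ n ∈ Finset.range N, E (n * (ω s - ω r)) = (if r = s then (N : ℂ) else 0) +
      Complex.I / 2 * (cs ω r s : ℂ) *
        (E (((N : ℝ) - 1 / 2) * ω s) * starRingEnd ℂ (E (((N : ℝ) - 1 / 2) * ω r)) -
        E (-1 / 2 * ω s) * starRingEnd ℂ (E (-1 / 2 * ω r))) := by
  by_cases h : r = s
  · subst h; simp [cs_self, E_zero]
  · rw [if_neg h, zero_add]
    have hs := sin_pi_ne hδ (hsep s r (Ne.symm h))
    have h1 := E_sum N (ω s - ω r)
    rw [E_sin] at h1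
    rw [E_conj, E_conj, ← E_add, ← E_add]
    rw [show ((N : ℝ) - 1 / 2) * ω s + -(((N : ℝ) - 1 / 2) * ω r) =
      ((N : ℝ) - 1 / 2) * (ω s - ω r) by ring,
      show -1 / 2 * ω s + -(-1 / 2 * ω r) = -((ω s - ω r) / 2) by ring, ← h1, cs_anti]
    unfold cs
    have hs' : (Real.sin (Real.pi * (ω s - ω r)) : ℂ) ≠ 0 := by exact_mod_cast hs
    generalize (∑ n ∈ Finset.range N, E (n * (ω s - ω r))) = T
    push_cast at hs' ⊢
    field_simp
    linear_combination T * Complex.I_sq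

lemma lower {S : ℕ} (ω : Fin S → ℝ) (δ : ℝ) (hδ : 0 < δ)
    (hsep : ∀ i j : Fin S, i ≠ j → ∀ k : ℤ, δ ≤ |ω i - ω j + (k : ℝ)|) (N : ℕ) (x : Fin S → ℂ) :
    ((N : ℝ) - 1 / δ) * ∑ r, ‖x r‖ ^ 2 ≤
      ∑ n ∈ Finset.range N, ‖∑ s, E (n * ω s) * x s‖ ^ 2 := by
  classical
  set y : Fin S → ℂ := fun s => E (((N : ℝ) - 1 / 2) * ω s) * x s with hy
  set z : Fin S → ℂ := fun s => E (-1 / 2 * ω s) * x s with hz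
  have h1 := hilbert_half ω δ hδ hsep 1 (by norm_num) y
  have h2 := hilbert_half ω δ hδ hsep (-1) (by norm_num) z
  have ny : ∑ r, ‖y r‖ ^ 2 = ∑ r, ‖x r‖ ^ 2 := by simp [hy, E_norm]
  have nz : ∑ r, ‖z r‖ ^ 2 = ∑ r, ‖x r‖ ^ 2 := by simp [hz, E_norm]
  rw [ny] at h1
  rw [nz] at h2
  have key : ((∑ n ∈ Finset.range N, ‖∑ s, E (n * ω s) * x s‖ ^ 2 : ℝ) : ℂ) =
      ((N * ∑ r, ‖x r‖ ^ 2 : ℝ) : ℂ) + Complex.I / 2 *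
        ((∑ r, ∑ s, starRingEnd ℂ (y r) * y s * (cs ω r s : ℂ)) -
         ∑ r, ∑ s, starRingEnd ℂ (z r) * z s * (cs ω r s : ℂ)) := by
    push_cast
    calc _ = ∑ n ∈ Finset.range N, ∑ r, ∑ s,
          starRingEnd ℂ (x r) * x s * E (n * (ω s - ω r)) := by
          refine Finset.sum_congr rfl fun n _ => ?_
          rw [← Complex.conj_mul', map_sum, Finset.sum_mul_sum]
          refine Finset.sum_congr rfl fun r _ => Finset.sum_congr rfl fun s _ => ?_
          rw [map_mul, E_conj, show (n : ℝ) * (ω s - ω r) = -(n * ω r) + n * ω s by ring, E_add]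
          ring
      _ = ∑ r, ∑ s, starRingEnd ℂ (x r) * x s * ∑ n ∈ Finset.range N, E (n * (ω s - ω r)) := by
          rw [Finset.sum_comm]
          refine Finset.sum_congr rfl fun r _ => ?_
          rw [Finset.sum_comm]
          refine Finset.sum_congr rfl fun s _ => ?_
          rw [Finset.mul_sum]
      _ = ∑ r, ∑ s, ((if r = s then starRingEnd ℂ (x r) * x s * (N : ℂ) else 0) +
            Complex.I / 2 * (starRingEnd ℂ (y r) * y s * (cs ω r s : ℂ) -
              starRingEnd ℂ (z r) * z s * (cs ω r s : ℂ))) := by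
          refine Finset.sum_congr rfl fun r _ => Finset.sum_congr rfl fun s _ => ?_
          rw [dirichlet ω δ hδ hsep N r s]
          simp only [hy, hz, map_mul]
          split_ifs <;> ring
      _ = _ := by
          simp only [Finset.sum_add_distrib, ← Finset.mul_sum, Finset.sum_sub_distrib]
          congr 1
          rw [Finset.mul_sum]
          refine Finset.sum_congr rfl fun r _ => ?_
          rw [Finset.sum_ite_eq, if_pos (Finset.mem_univ r), Complex.conj_mul']; ring
  have hre := congrArg Complex.re key
  rw [Complex.add_re, Complex.ofReal_re, Complex.ofReal_re] at hre
  rw [show ∀ w : ℂ, (Complex.I / 2 * w).re = -(w.im / 2) by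
    intro w
    rw [show Complex.I / 2 * w = ((1 / 2 : ℝ) : ℂ) * (Complex.I * w) by push_cast; ring,
      Complex.re_ofReal_mul, Complex.I_mul_re]; ring, Complex.sub_im] at hre
  rw [hre]
  linarith

lemma sval_ge {m n : ℕ} (hn : 1 ≤ n) (A : Matrix (Fin m) (Fin n) ℂ) (r : ℝ) (hr : 0 ≤ r)
    (h : ∀ x : EuclideanSpace ℂ (Fin n), r * ‖x‖ ≤ ‖Matrix.toEuclideanLin A x‖) :
    r ≤ sval A n := by
  unfold sval
  apply le_csSup
  · refine ⟨‖LinearMap.toContinuousLinearMap (Matrix.toEuclideanLin A)‖, ?_⟩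
    rintro q ⟨hq, V, hV, hx⟩
    have : Nontrivial V := Module.nontrivial_of_finrank_pos (R := ℂ) (by omega)
    obtain ⟨v, hv⟩ := exists_ne (0 : V)
    have h1 := hx v v.2
    have h2 := (LinearMap.toContinuousLinearMap (Matrix.toEuclideanLin A)).le_opNorm (v : EuclideanSpace ℂ (Fin n))
    have h3 : 0 < ‖(v : EuclideanSpace ℂ (Fin n))‖ := by
      rw [norm_pos_iff]; exact_mod_cast hv
    exact le_of_mul_le_mul_right (h1.trans h2) h3
  · exact ⟨hr, ⊤, by simp, fun x _ => h x⟩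

/-- **Proposition 2 (well-separated singular value bound for the nested array).** For the
nested array with `N₁ = ⌈P/2⌉`, `N₂ = ⌊P/2⌋` and coarray ULA `{0,…,M_ca}` with
`M_ca = N₂(N₁+1)−1`, if `S ≤ P²/5` and `Δ_min(ω) ≥ 5γ/P²` for some `γ > 1`, then
`σ_S(A_U(ω))² ≥ P²/C_n′` with `C_n′ = 5γ/(γ−1)`. -/
theorem nested_well_separated_singular_value (P N₁ N₂ Mca S : ℕ) (hP : 3 ≤ P)
    (hN₁ : N₁ = (P + 1) / 2) (hN₂ : N₂ = P / 2) (hMca : Mca = N₂ * (N₁ + 1) - 1)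
    (hS : 1 ≤ S) (hSP : (S : ℝ) ≤ (P : ℝ) ^ 2 / 5)
    (ω : Fin S → ℝ) (hω01 : ∀ i, ω i ∈ Set.Ico (0 : ℝ) 1) (hinj : Function.Injective ω)
    (γ : ℝ) (hγ : 1 < γ)
    (hsep : ∀ i j : Fin S, i ≠ j → ∀ k : ℤ, 5 * γ / (P : ℝ) ^ 2 ≤ |ω i - ω j + (k : ℝ)|) :
    (P : ℝ) ^ 2 / (5 * γ / (γ - 1)) ≤
      sval (steering (fun k : Fin (Mca + 1) => (k : ℤ)) ω) S ^ 2 := by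
  have hPr : (3 : ℝ) ≤ P := by exact_mod_cast hP
  have hδ : 0 < 5 * γ / (P : ℝ) ^ 2 := by positivity
  have hN : (P : ℝ) ^ 2 / 5 ≤ ((Mca + 1 : ℕ) : ℝ) := by
    have hge : 4 * (Mca + 1) ≥ P ^ 2 := by
      have h1 : 1 ≤ N₂ * (N₁ + 1) := Nat.mul_pos (by omega) (by omega)
      have h2 : Mca + 1 = N₂ * (N₁ + 1) := by omega
      rw [h2]
      rcases Nat.even_or_odd' P with ⟨q, hq | hq⟩
      · have a : N₁ = q := by omega
        have b : N₂ = q := by omega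
        rw [a, b, hq]
        nlinarith
      · have a : N₁ = q + 1 := by omega
        have b : N₂ = q := by omega
        rw [a, b, hq]
        have : 1 ≤ q := by omega
        nlinarith
    have : (P : ℝ) ^ 2 ≤ 4 * ((Mca + 1 : ℕ) : ℝ) := by exact_mod_cast hge
    have := sq_nonneg (P : ℝ)
    linarith
  have hL : 0 ≤ (P : ℝ) ^ 2 / (5 * γ / (γ - 1)) := by
    have : 0 < γ - 1 := by linarith
    positivity
  have hle : (P : ℝ) ^ 2 / (5 * γ / (γ - 1)) ≤ ((Mca + 1 : ℕ) : ℝ) - 1 / (5 * γ / (P : ℝ) ^ 2) := by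
    have h1 : 0 < γ - 1 := by linarith
    have : (P : ℝ) ^ 2 / (5 * γ / (γ - 1)) = (P : ℝ) ^ 2 / 5 - 1 / (5 * γ / (P : ℝ) ^ 2) := by
      field_simp
    linarith
  have hs := sval_ge hS (steering (fun k : Fin (Mca + 1) => (k : ℤ)) ω)
    (Real.sqrt ((P : ℝ) ^ 2 / (5 * γ / (γ - 1)))) (Real.sqrt_nonneg _) (by
      intro x
      have h := lower ω _ hδ hsep (Mca + 1) x.ofLp
      apply le_of_sq_le_sq _ (norm_nonneg _)
      rw [mul_pow, Real.sq_sqrt hL, EuclideanSpace.norm_sq_eq, EuclideanSpace.norm_sq_eq]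
      refine (mul_le_mul_of_nonneg_right hle (by positivity)).trans (h.trans (le_of_eq ?_))
      rw [Finset.sum_range]
      refine Finset.sum_congr rfl fun n _ => ?_
      congr 2
      simp only [Matrix.toLpLin_apply, Matrix.mulVec, dotProduct, steering, Matrix.of_apply]
      refine Finset.sum_congr rfl fun s _ => ?_
      congr 1
      unfold E
      congr 1
      push_cast
      ring)
  calc _ = Real.sqrt ((P : ℝ) ^ 2 / (5 * γ / (γ - 1))) ^ 2 := (Real.sq_sqrt hL).symm
    _ ≤ _ := pow_le_pow_left₀ (Real.sqrt_nonneg _) hs 2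
end
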